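/- arXiv:0805.4682 — 5 statements merged into one kernel-verified Lean document; each statement's English description precedes it below -/
import Mathlib

section
/- For every integer k ≥ 1 and every k-tuple h = (h_1,…,h_k) of distinct positive integers, the Euler product defining the singular series converges absolutely: the sum over all primes p of |(1 − ν_p(h)/p)(1 − 1/p)^{−k} − 1| is finite, so the product S(h) = ∏_p (1 − ν_p(h)/p)(1 − 1/p)^{−k} over all primes converges (the family of factors is multipliable). -/
open Filter Topology

noncomputable def nup {k : ℕ} (h : Fin k → ℕ) (p : ℕ) : ℕ :=
  (Set.range fun i => ((h i : ZMod p))).ncard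

/-- The `p`-factor `(1 - ν_p(h)/p) * (1 - 1/p)^(-k)` of the singular series. -/
noncomputable def singFactor {k : ℕ} (h : Fin k → ℕ) (p : ℕ) : ℝ :=
  (1 - (nup h p : ℝ) / p) * (1 - 1 / (p : ℝ)) ^ (-(k : ℤ))

/-- The singular series `S(h) = ∏_p (1 - ν_p(h)/p)(1 - 1/p)^(-k)`. -/
noncomputable def singSeries {k : ℕ} (h : Fin k → ℕ) : ℝ :=
  ∏' p : Nat.Primes, singFactor h (p : ℕ)

/-- The `k`-tuples of distinct positive integers with all entries `≤ H`. -/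
def distinctTuples (k H : ℕ) : Finset (Fin k → ℕ) :=
  (Fintype.piFinset fun _ : Fin k => Finset.Icc 1 H).filter Function.Injective

lemma one_sub_pow_le_quadratic (k : ℕ) {x : ℝ} (hx : 0 ≤ x) (hx1 : x ≤ 1) :
    (1 - x) ^ k ≤ 1 - k * x + k ^ 2 * x ^ 2 := by
  induction k with
  | zero => simp
  | succ k ih =>
    have hk : (0 : ℝ) ≤ k := k.cast_nonneg
    calc (1 - x) ^ (k + 1) = (1 - x) ^ k * (1 - x) := pow_succ _ _
      _ ≤ (1 - k * x + k ^ 2 * x ^ 2) * (1 - x) :=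
        mul_le_mul_of_nonneg_right ih (sub_nonneg.2 hx1)
      _ ≤ 1 - ((k + 1 : ℕ) : ℝ) * x + ((k + 1 : ℕ) : ℝ) ^ 2 * x ^ 2 := by
        push_cast
        have h₁ : 0 ≤ (k : ℝ) ^ 2 * x ^ 3 := by positivity
        have h₂ : 0 ≤ ((k : ℝ) + 1) * x ^ 2 := by positivity
        linarith

lemma abs_one_sub_mul_mul_zpow_sub_one_le (k : ℕ) {x : ℝ} (hx : 0 ≤ x) (hx2 : x ≤ 1 / 2) :
    |(1 - k * x) * (1 - x) ^ (-(k : ℤ)) - 1| ≤ 2 ^ k * k ^ 2 * x ^ 2 := by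
  have hpos : 0 < (1 - x) ^ k := pow_pos (by linarith) k
  have hlower : 1 - k * x ≤ (1 - x) ^ k := by
    have := one_add_mul_le_pow (a := -x) (by linarith) k
    simpa [sub_eq_add_neg] using this
  have hupper := one_sub_pow_le_quadratic k hx (by linarith)
  have hhalf : 1 ≤ 2 ^ k * (1 - x) ^ k := by
    rw [← mul_pow]
    exact one_le_pow₀ (by linarith)
  have hsq : 0 ≤ (k : ℝ) ^ 2 * x ^ 2 := by positivity
  have heq : (1 - k * x) * (1 - x) ^ (-(k : ℤ)) - 1
      = -(((1 - x) ^ k - (1 - k * x)) / (1 - x) ^ k) := by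
    rw [zpow_neg, zpow_natCast]
    field_simp
    ring
  rw [heq, abs_neg, abs_of_nonneg (div_nonneg (sub_nonneg.2 hlower) hpos.le), div_le_iff₀ hpos]
  calc (1 - x) ^ k - (1 - k * x) ≤ k ^ 2 * x ^ 2 := by linarith
    _ ≤ k ^ 2 * x ^ 2 * (2 ^ k * (1 - x) ^ k) := le_mul_of_one_le_right hsq hhalf
    _ = 2 ^ k * k ^ 2 * x ^ 2 * (1 - x) ^ k := by ring

lemma nup_eq_of_forall_lt {k : ℕ} {h : Fin k → ℕ} (hinj : Function.Injective h) {p : ℕ}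
    (hp : ∀ i, h i < p) : nup h p = k := by
  have hcast : Function.Injective fun i => (h i : ZMod p) := fun i j hij =>
    hinj (Nat.ModEq.eq_of_lt_of_lt ((ZMod.natCast_eq_natCast_iff _ _ _).1 hij) (hp i) (hp j))
  rw [nup, ← Nat.card_coe_set_eq, Nat.card_range_of_injective hcast, Nat.card_fin]

/-- For every `k ≥ 1` and every `k`-tuple of distinct positive integers, the Euler
product defining the singular series converges absolutely: the sum over all primes of
`|(1 - ν_p(h)/p)(1 - 1/p)^(-k) - 1|` is finite, so the family of factors is
multipliable. -/
theorem singSeries_abs_convergent (k : ℕ) (hk : 1 ≤ k) (h : Fin k → ℕ)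
    (hpos : ∀ i, 1 ≤ h i) (hinj : Function.Injective h) :
    Summable (fun p : Nat.Primes => |singFactor h (p : ℕ) - 1|) ∧
      Multipliable (fun p : Nat.Primes => singFactor h (p : ℕ)) := by
  have hsum : Summable fun p : Nat.Primes => |singFactor h (p : ℕ) - 1| := by
    have hbound : Summable fun p : Nat.Primes => 2 ^ k * (k : ℝ) ^ 2 * (1 / (p : ℝ)) ^ 2 := by
      refine Summable.mul_left _ ?_
      simp only [one_div, inv_pow]
      exact (Real.summable_nat_pow_inv.2 one_lt_two).comp_injective Nat.Primes.coe_nat_injective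
    have hlarge : ∀ᶠ p : Nat.Primes in cofinite, ∀ i, h i < p := by
      have htends : Tendsto (fun p : Nat.Primes => (p : ℕ)) cofinite atTop :=
        Nat.cofinite_eq_atTop ▸ Nat.Primes.coe_nat_injective.tendsto_cofinite
      exact eventually_all.2 fun i => htends.eventually_gt_atTop (h i)
    refine hbound.of_norm_bounded_eventually ?_
    filter_upwards [hlarge] with p hp
    have hp2 : (2 : ℝ) ≤ p := by exact_mod_cast p.prop.two_le
    have := abs_one_sub_mul_mul_zpow_sub_one_le k (x := 1 / (p : ℝ)) (by positivity)
      (one_div_le_one_div_of_le two_pos hp2)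
    rwa [Real.norm_eq_abs, abs_abs, singFactor, nup_eq_of_forall_lt hinj hp, div_eq_mul_one_div]
  refine ⟨hsum, ?_⟩
  simpa using multipliable_one_add_of_summable (f := fun p : Nat.Primes => singFactor h p - 1)
    (by simpa only [Real.norm_eq_abs] using hsum)
end

section
/- For every fixed integer k ≥ 1 and every real number m ≥ 0 there exists a real number μ_k(m) such that lim_{h→∞} h^{−k} · Σ* S(h)^m = μ_k(m), where the sum Σ* runs over all k-tuples h = (h_1,…,h_k) of distinct positive integers with h_i ≤ h for all i, and where S(h)^m is interpreted as 0 whenever S(h) = 0 (in particular also for m = 0). -/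
open Filter Topology

/-- The primes in the interval `(N, M]`. -/
def primesIoc (N M : ℕ) : Finset ℕ := (Finset.Ioc N M).filter Nat.Prime

/-- The sum of `1 / p` over the prime divisors `p` of `n` in the interval `(N, M]`. -/
noncomputable def primeRecipSum (N M n : ℕ) : ℝ :=
  ∑ p ∈ primesIoc N M, if p ∣ n then 1 / (p : ℝ) else 0

/-- The sum of `primeRecipSum` over the differences of the entries of a tuple. -/
noncomputable def tupleRecipSum {k : ℕ} (N M : ℕ) (h : Fin k → ℕ) : ℝ :=
  ∑ q ∈ (Finset.univ : Finset (Fin k)).offDiag,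
    primeRecipSum N M ((h q.1 : ℤ) - (h q.2 : ℤ)).natAbs

/-- The product of the factors of the singular series over the primes up to `N`. -/
noncomputable def partialSeries {k : ℕ} (N : ℕ) (h : Fin k → ℕ) : ℝ :=
  ∏ p ∈ primesIoc 0 N, singFactor h p

/-- The power `x ^ m`, interpreted as `0` at `x = 0` for every `m`. -/
noncomputable def truncPow (m x : ℝ) : ℝ := if x = 0 then 0 else x ^ m

lemma mem_primesIoc {N M p : ℕ} : p ∈ primesIoc N M ↔ (N < p ∧ p ≤ M) ∧ p.Prime := by
  simp [primesIoc]

lemma sum_primesIoc_inv_sq_le (N M : ℕ) :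
    ∑ p ∈ primesIoc N M, ((p : ℝ) ^ 2)⁻¹ ≤ 2 / ((N : ℝ) + 1) := by
  refine le_trans ?_ (sum_Ioo_inv_sq_le N (M + 1))
  refine Finset.sum_le_sum_of_subset_of_nonneg ?_ (fun _ _ _ => by positivity)
  intro p hp
  rw [mem_primesIoc] at hp
  simp only [Finset.mem_Ioo]
  omega

lemma primeRecipSum_nonneg (N M n : ℕ) : 0 ≤ primeRecipSum N M n :=
  Finset.sum_nonneg fun p _ => by split_ifs <;> positivity

lemma tupleRecipSum_nonneg {k : ℕ} (N M : ℕ) (h : Fin k → ℕ) : 0 ≤ tupleRecipSum N M h :=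
  Finset.sum_nonneg fun _ _ => primeRecipSum_nonneg _ _ _

lemma prod_primesIoc_mul {N M : ℕ} (hNM : N ≤ M) (f : ℕ → ℝ) :
    (∏ p ∈ primesIoc 0 N, f p) * ∏ p ∈ primesIoc N M, f p = ∏ p ∈ primesIoc 0 M, f p := by
  rw [← Finset.prod_union]
  · congr 1
    ext p
    simp only [Finset.mem_union, mem_primesIoc]
    constructor
    · rintro (⟨⟨_, _⟩, hp⟩ | ⟨⟨_, _⟩, hp⟩) <;> exact ⟨⟨by omega, by omega⟩, hp⟩
    · rintro ⟨⟨h1, h2⟩, hp⟩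
      by_cases h3 : p ≤ N
      · exact Or.inl ⟨⟨h1, h3⟩, hp⟩
      · exact Or.inr ⟨⟨by omega, h2⟩, hp⟩
  · rw [Finset.disjoint_left]
    intro p h1 h2
    rw [mem_primesIoc] at h1 h2
    omega

/-! ### Averages of exponentials of prime reciprocal sums -/

lemma card_filter_prod_dvd_le (H : ℕ) (T : Finset ℕ) (hT : ∀ p ∈ T, p.Prime) :
    (((Finset.Icc 1 H).filter fun n => ∀ p ∈ T, p ∣ n).card : ℝ) ≤ H * ∏ p ∈ T, (1 / (p : ℝ)) := by
  have h1 : ((Finset.Icc 1 H).filter fun n => ∀ p ∈ T, p ∣ n) ⊆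
      (Finset.Ioc 0 H).filter fun n => (∏ p ∈ T, p) ∣ n := by
    intro n hn
    simp only [Finset.mem_filter, Finset.mem_Icc, Finset.mem_Ioc] at hn ⊢
    exact ⟨⟨by omega, hn.1.2⟩,
      Finset.prod_primes_dvd n (fun p hp => (hT p hp).prime) (fun p hp => hn.2 p hp)⟩
  have h2 := Finset.card_le_card h1
  rw [Nat.Ioc_filter_dvd_card_eq_div] at h2
  calc _ ≤ ((H / ∏ p ∈ T, p : ℕ) : ℝ) := by exact_mod_cast h2
    _ ≤ (H : ℝ) / ((∏ p ∈ T, p : ℕ) : ℝ) := Nat.cast_div_le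
    _ = _ := by
      rw [div_eq_mul_inv]; push_cast; simp

lemma sum_prod_one_add_le (H : ℕ) (P : Finset ℕ) (hP : ∀ p ∈ P, p.Prime) (g : ℕ → ℝ)
    (hg : ∀ p, 0 ≤ g p) :
    ∑ n ∈ Finset.Icc 1 H, ∏ p ∈ P, (1 + if p ∣ n then g p else 0) ≤
      H * ∏ p ∈ P, (1 + g p * (1 / (p : ℝ))) := by
  simp_rw [Finset.prod_one_add]
  rw [Finset.sum_comm, Finset.mul_sum]
  refine Finset.sum_le_sum fun T hT => ?_
  rw [Finset.mem_powerset] at hT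
  have h1 : ∀ n, (∏ p ∈ T, if p ∣ n then g p else 0) =
      if ∀ p ∈ T, p ∣ n then ∏ p ∈ T, g p else 0 := by
    intro n
    split_ifs with h
    · exact Finset.prod_congr rfl fun p hp => if_pos (h p hp)
    · push Not at h
      obtain ⟨p, hp, hpn⟩ := h
      exact Finset.prod_eq_zero hp (if_neg hpn)
  simp_rw [h1]
  rw [← Finset.sum_filter, Finset.sum_const, nsmul_eq_mul, Finset.prod_mul_distrib]
  have h2 := card_filter_prod_dvd_le H T fun p hp => hP p (hT hp)
  have h3 : 0 ≤ ∏ p ∈ T, g p := Finset.prod_nonneg fun p _ => hg p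
  calc _ ≤ (H * ∏ p ∈ T, (1 / (p : ℝ))) * ∏ p ∈ T, g p := mul_le_mul_of_nonneg_right h2 h3
    _ = _ := by ring

lemma exp_sub_one_le_mul_exp (x : ℝ) : Real.exp x - 1 ≤ x * Real.exp x := by
  have h := Real.add_one_le_exp (-x)
  have h2 : Real.exp (-x) * Real.exp x = 1 := by rw [← Real.exp_add]; simp
  nlinarith [Real.exp_pos x]

lemma sum_exp_primeRecipSum_le {B : ℝ} (hB : 0 ≤ B) (N M H : ℕ) :
    ∑ n ∈ Finset.Icc 1 H, Real.exp (B * primeRecipSum N M n) ≤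
      H * Real.exp (B * Real.exp B * (2 / ((N : ℝ) + 1))) := by
  have h1 : ∀ n, Real.exp (B * primeRecipSum N M n) =
      ∏ p ∈ primesIoc N M, (1 + if p ∣ n then Real.exp (B * (1 / p)) - 1 else 0) := by
    intro n
    rw [primeRecipSum, Finset.mul_sum, Real.exp_sum]
    refine Finset.prod_congr rfl fun p _ => ?_
    split_ifs <;> simp
  simp_rw [h1]
  refine (sum_prod_one_add_le H _ (fun p hp => (mem_primesIoc.1 hp).2)
    (fun p => Real.exp (B * (1 / p)) - 1) fun p => ?_).trans ?_
  · have : 0 ≤ B * (1 / (p : ℝ)) := by positivity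
    linarith [Real.add_one_le_exp (B * (1 / (p : ℝ)))]
  · refine mul_le_mul_of_nonneg_left ?_ (Nat.cast_nonneg _)
    calc _ ≤ ∏ p ∈ primesIoc N M, Real.exp (B * Real.exp B * ((p : ℝ) ^ 2)⁻¹) := by
          refine Finset.prod_le_prod (fun p _ => ?_) fun p hp => ?_
          · have : 0 ≤ B * (1 / (p : ℝ)) := by positivity
            have : 0 ≤ Real.exp (B * (1 / (p : ℝ))) - 1 := by
              linarith [Real.add_one_le_exp (B * (1 / (p : ℝ)))]
            positivity
          · have hp1 : (1 : ℝ) ≤ p := by exact_mod_cast (mem_primesIoc.1 hp).2.one_lt.le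
            have h2 : 1 / (p : ℝ) ≤ 1 := by rw [div_le_one (by linarith)]; exact hp1
            have h3 : Real.exp (B * (1 / p)) - 1 ≤ B * (1 / p) * Real.exp B := by
              refine (exp_sub_one_le_mul_exp _).trans ?_
              refine mul_le_mul_of_nonneg_left (Real.exp_le_exp.2 ?_) (by positivity)
              nlinarith
            have h4 : (Real.exp (B * (1 / p)) - 1) * (1 / (p : ℝ)) ≤
                B * (1 / p) * Real.exp B * (1 / (p : ℝ)) :=
              mul_le_mul_of_nonneg_right h3 (by positivity)
            have h5 : B * (1 / p) * Real.exp B * (1 / (p : ℝ)) =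
                B * Real.exp B * ((p : ℝ) ^ 2)⁻¹ := by field_simp
            linarith [Real.add_one_le_exp (B * Real.exp B * ((p : ℝ) ^ 2)⁻¹)]
      _ = Real.exp (B * Real.exp B * ∑ p ∈ primesIoc N M, ((p : ℝ) ^ 2)⁻¹) := by
          rw [Finset.mul_sum, Real.exp_sum]
      _ ≤ _ := by
          refine Real.exp_le_exp.2 (mul_le_mul_of_nonneg_left (sum_primesIoc_inv_sq_le N M) ?_)
          positivity

lemma sum_natAbs_sub_le (H a : ℕ) (ha : a ∈ Finset.Icc 1 H) (φ : ℕ → ℝ) (hφ : ∀ n, 0 ≤ φ n) :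
    ∑ b ∈ Finset.Icc 1 H, (if a = b then 0 else φ ((a : ℤ) - (b : ℤ)).natAbs) ≤
      2 * ∑ n ∈ Finset.Icc 1 H, φ n := by
  simp only [Finset.mem_Icc] at ha
  have h0 : ∀ b : ℕ, (if a = b then 0 else φ ((a : ℤ) - (b : ℤ)).natAbs) =
      (if b < a then φ ((a : ℤ) - (b : ℤ)).natAbs else 0) +
      (if a < b then φ ((a : ℤ) - (b : ℤ)).natAbs else 0) := by
    intro b
    rcases lt_trichotomy a b with h | h | h
    · simp [h, h.ne, h.not_gt]
    · simp [h]
    · simp [h, h.ne', h.not_gt]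
  simp_rw [h0]
  rw [Finset.sum_add_distrib, two_mul, ← Finset.sum_filter, ← Finset.sum_filter]
  refine add_le_add ?_ ?_
  all_goals
    rw [← Finset.sum_image (f := φ) (g := fun b : ℕ => ((a : ℤ) - (b : ℤ)).natAbs)]
    · refine Finset.sum_le_sum_of_subset_of_nonneg ?_ fun _ _ _ => hφ _
      intro n hn
      simp only [Finset.mem_image, Finset.mem_filter, Finset.mem_Icc] at hn ⊢
      obtain ⟨b, hb, rfl⟩ := hn
      omega
    · intro b hb c hc hbc
      simp only [Finset.coe_filter, Finset.mem_Icc, Set.mem_ofPred_eq] at hb hc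
      simp only at hbc
      omega

lemma sum_piFinset_pair_le {k : ℕ} (s : Finset ℕ) (i j : Fin k) (hij : i ≠ j)
    (Φ : ℕ → ℕ → ℝ) (hΦ : ∀ a b, 0 ≤ Φ a b) :
    (s.card : ℝ) ^ 2 * ∑ h ∈ Fintype.piFinset (fun _ : Fin k => s), Φ (h i) (h j) ≤
      (s.card : ℝ) ^ k * ∑ a ∈ s, ∑ b ∈ s, Φ a b := by
  have hmaps : ∀ h ∈ Fintype.piFinset (fun _ : Fin k => s), (h i, h j) ∈ s ×ˢ s := by
    intro h hh
    rw [Fintype.mem_piFinset] at hh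
    exact Finset.mem_product.2 ⟨hh i, hh j⟩
  rw [← Finset.sum_fiberwise_of_maps_to hmaps, ← Finset.sum_product', Finset.mul_sum,
    Finset.mul_sum]
  refine Finset.sum_le_sum fun q _ => ?_
  have hconst : ∑ h ∈ Fintype.piFinset (fun _ : Fin k => s) with (h i, h j) = q, Φ (h i) (h j) =
      ((Fintype.piFinset (fun _ : Fin k => s)).filter fun h => (h i, h j) = q).card *
        Φ q.1 q.2 := by
    rw [← nsmul_eq_mul, ← Finset.sum_const]
    refine Finset.sum_congr rfl fun h hh => ?_
    have := (Finset.mem_filter.1 hh).2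
    rw [← this]
  rw [hconst, ← mul_assoc]
  refine mul_le_mul_of_nonneg_right ?_ (hΦ _ _)
  have hsub : ((Fintype.piFinset (fun _ : Fin k => s)).filter fun h => (h i, h j) = q) ⊆
      Fintype.piFinset (fun l : Fin k => if l = i then {q.1} else if l = j then {q.2} else s) := by
    intro h hh
    simp only [Finset.mem_filter, Fintype.mem_piFinset] at hh ⊢
    intro l
    split_ifs with h1 h2
    · simp [h1, ← hh.2]
    · simp [h2, ← hh.2]
    · exact hh.1 l
  have hcard := Finset.card_le_card hsub
  rw [Fintype.card_piFinset] at hcard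
  have hsq : ∏ l : Fin k, ((if l = i then s.card else 1) * (if l = j then s.card else 1)) =
      s.card ^ 2 := by
    rw [Finset.prod_mul_distrib]
    simp [sq]
  have hpow : s.card ^ 2 * ∏ l : Fin k,
      (if l = i then {q.1} else if l = j then {q.2} else s : Finset ℕ).card = s.card ^ k := by
    rw [← hsq, ← Finset.prod_mul_distrib]
    have : ∀ l ∈ (Finset.univ : Finset (Fin k)),
        ((if l = i then s.card else 1) * (if l = j then s.card else 1)) *
          (if l = i then {q.1} else if l = j then {q.2} else s : Finset ℕ).card = s.card := by
      intro l _
      by_cases h1 : l = i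
      · subst h1
        simp [hij]
      · by_cases h2 : l = j
        · subst h2
          simp [h1]
        · simp [h1, h2]
    rw [Finset.prod_congr rfl this]
    simp
  have : s.card ^ 2 *
      ((Fintype.piFinset (fun _ : Fin k => s)).filter fun h => (h i, h j) = q).card ≤
        s.card ^ k := by
    rw [← hpow]
    exact Nat.mul_le_mul_left _ hcard
  exact_mod_cast this

lemma exp_sum_sub_one_le {ι : Type*} (s : Finset ι) (x : ι → ℝ) (hx : ∀ i, 0 ≤ x i) :
    Real.exp (∑ i ∈ s, x i) - 1 ≤ ∑ i ∈ s, (Real.exp (s.card * x i) - 1) := by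
  rcases s.eq_empty_or_nonempty with rfl | hs
  · simp
  obtain ⟨j, hj, hmax⟩ := s.exists_max_image x hs
  have h1 : ∑ i ∈ s, x i ≤ s.card * x j := by
    rw [← nsmul_eq_mul]
    exact Finset.sum_le_card_nsmul _ _ _ hmax
  have h2 : ∀ i ∈ s, 0 ≤ Real.exp (s.card * x i) - 1 := by
    intro i _
    have : 0 ≤ s.card * x i := mul_nonneg (Nat.cast_nonneg _) (hx i)
    linarith [Real.add_one_le_exp (s.card * x i)]
  exact (sub_le_sub_right (Real.exp_le_exp.2 h1) 1).trans
    (Finset.single_le_sum (f := fun i => Real.exp (s.card * x i) - 1) h2 hj)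

lemma sum_distinctTuples_exp_sub_one_le (k : ℕ) {B : ℝ} (hB : 0 ≤ B) :
    ∃ C : ℝ, 0 ≤ C ∧ ∀ N M H : ℕ,
      ∑ h ∈ distinctTuples k H, (Real.exp (B * tupleRecipSum N M h) - 1) ≤
        (C * (Real.exp (C * (2 / ((N : ℝ) + 1))) - 1)) * (H : ℝ) ^ k := by
  set Q := (Finset.univ : Finset (Fin k)).offDiag with hQ
  set B' : ℝ := Q.card * B with hB'
  have hB'0 : 0 ≤ B' := by positivity
  set C : ℝ := max (B' * Real.exp B') (2 * Q.card) with hC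
  have hC0 : 0 ≤ C := le_max_of_le_left (by positivity)
  refine ⟨C, hC0, fun N M H => ?_⟩
  set D : ℝ := Real.exp (C * (2 / ((N : ℝ) + 1))) - 1 with hD
  have hD0 : 0 ≤ D := by
    have : 0 ≤ C * (2 / ((N : ℝ) + 1)) := by positivity
    linarith [Real.add_one_le_exp (C * (2 / ((N : ℝ) + 1)))]
  set φ : ℕ → ℝ := fun n => Real.exp (B' * primeRecipSum N M n) - 1 with hφ
  have hφ0 : ∀ n, 0 ≤ φ n := by
    intro n
    have : 0 ≤ B' * primeRecipSum N M n := mul_nonneg hB'0 (primeRecipSum_nonneg _ _ _)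
    simp only [hφ]
    linarith [Real.add_one_le_exp (B' * primeRecipSum N M n)]
  have hφsum : ∑ n ∈ Finset.Icc 1 H, φ n ≤ H * D := by
    have h1 := sum_exp_primeRecipSum_le hB'0 N M H
    have h2 : Real.exp (B' * Real.exp B' * (2 / ((N : ℝ) + 1))) ≤ D + 1 := by
      rw [hD, sub_add_cancel]
      exact Real.exp_le_exp.2 (mul_le_mul_of_nonneg_right (le_max_left _ _) (by positivity))
    have h3 := mul_le_mul_of_nonneg_left h2 (Nat.cast_nonneg (α := ℝ) H)
    simp only [hφ, Finset.sum_sub_distrib, Finset.sum_const, Nat.card_Icc]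
    simp only [Nat.add_sub_cancel, nsmul_eq_mul, mul_one]
    linarith
  set Φ : ℕ → ℕ → ℝ := fun a b => if a = b then 0 else φ ((a : ℤ) - (b : ℤ)).natAbs with hΦ
  have hΦ0 : ∀ a b, 0 ≤ Φ a b := by
    intro a b
    simp only [hΦ]
    split_ifs
    exacts [le_rfl, hφ0 _]
  have hΦsum : ∑ a ∈ Finset.Icc 1 H, ∑ b ∈ Finset.Icc 1 H, Φ a b ≤ H * (2 * (H * D)) := by
    calc _ ≤ ∑ a ∈ Finset.Icc 1 H, 2 * (H * D) := by
          refine Finset.sum_le_sum fun a ha => (sum_natAbs_sub_le H a ha φ hφ0).trans ?_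
          linarith
      _ = _ := by simp
  have hpair : ∀ q ∈ Q, ∑ h ∈ Fintype.piFinset (fun _ : Fin k => Finset.Icc 1 H),
      Φ (h q.1) (h q.2) ≤ 2 * D * (H : ℝ) ^ k := by
    intro q hq
    have hne : q.1 ≠ q.2 := (Finset.mem_offDiag.1 hq).2.2
    have h1 := sum_piFinset_pair_le (Finset.Icc 1 H) q.1 q.2 hne Φ hΦ0
    rcases Nat.eq_zero_or_pos H with rfl | hH
    · have hemp : Fintype.piFinset (fun _ : Fin k => Finset.Icc 1 0) = ∅ := by
        rw [Finset.eq_empty_iff_forall_notMem]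
        intro h hh
        have := (Fintype.mem_piFinset.1 hh) q.1
        simp at this
      rw [hemp, Finset.sum_empty]
      positivity
    · simp only [Nat.card_Icc, Nat.add_sub_cancel] at h1
      have hHp : (0 : ℝ) < (H : ℝ) ^ 2 := by positivity
      have h2 := h1.trans (mul_le_mul_of_nonneg_left hΦsum (by positivity))
      refine le_of_mul_le_mul_left (h2.trans (le_of_eq ?_)) hHp
      ring
  calc ∑ h ∈ distinctTuples k H, (Real.exp (B * tupleRecipSum N M h) - 1)
      ≤ ∑ h ∈ distinctTuples k H, ∑ q ∈ Q, Φ (h q.1) (h q.2) := by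
        refine Finset.sum_le_sum fun h hh => ?_
        have hinj : Function.Injective h := (Finset.mem_filter.1 hh).2
        rw [tupleRecipSum, Finset.mul_sum]
        refine (exp_sum_sub_one_le _ _ fun q =>
          mul_nonneg hB (primeRecipSum_nonneg _ _ _)).trans (le_of_eq ?_)
        refine Finset.sum_congr rfl fun q hq => ?_
        have hne : h q.1 ≠ h q.2 := hinj.ne (Finset.mem_offDiag.1 hq).2.2
        simp only [hΦ, hφ, if_neg hne, hB', mul_assoc, ← hQ]
    _ ≤ ∑ h ∈ Fintype.piFinset (fun _ : Fin k => Finset.Icc 1 H),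
          ∑ q ∈ Q, Φ (h q.1) (h q.2) :=
        Finset.sum_le_sum_of_subset_of_nonneg (Finset.filter_subset _ _)
          fun _ _ _ => Finset.sum_nonneg fun _ _ => hΦ0 _ _
    _ = ∑ q ∈ Q, ∑ h ∈ Fintype.piFinset (fun _ : Fin k => Finset.Icc 1 H),
          Φ (h q.1) (h q.2) := Finset.sum_comm
    _ ≤ ∑ q ∈ Q, 2 * D * (H : ℝ) ^ k := Finset.sum_le_sum hpair
    _ = (2 * Q.card * D) * (H : ℝ) ^ k := by
        rw [Finset.sum_const, nsmul_eq_mul]; ring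
    _ ≤ (C * D) * (H : ℝ) ^ k := by
        gcongr
        exact le_max_right _ _

/-! ### Bounds for the factors of the singular series -/

/-- The contribution of a single prime to `tupleRecipSum`. -/
noncomputable def primeDefect {k : ℕ} (h : Fin k → ℕ) (p : ℕ) : ℝ :=
  ∑ q ∈ (Finset.univ : Finset (Fin k)).offDiag,
    if p ∣ ((h q.1 : ℤ) - (h q.2 : ℤ)).natAbs then 1 / (p : ℝ) else 0

lemma primeDefect_nonneg {k : ℕ} (h : Fin k → ℕ) (p : ℕ) : 0 ≤ primeDefect h p :=
  Finset.sum_nonneg fun _ _ => by split_ifs <;> positivity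

lemma tupleRecipSum_eq_sum_primeDefect {k : ℕ} (N M : ℕ) (h : Fin k → ℕ) :
    tupleRecipSum N M h = ∑ p ∈ primesIoc N M, primeDefect h p := by
  simp only [tupleRecipSum, primeRecipSum, primeDefect]
  exact Finset.sum_comm

lemma nup_le {k : ℕ} (h : Fin k → ℕ) (p : ℕ) : nup h p ≤ k := by
  rw [nup, ← Set.image_univ]
  refine (Set.ncard_image_le (Set.finite_univ)).trans ?_
  simp [Set.ncard_univ]

lemma nup_le_prime {k : ℕ} (h : Fin k → ℕ) {p : ℕ} (hp : p.Prime) : nup h p ≤ p := by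
  have : NeZero p := ⟨hp.ne_zero⟩
  rw [nup]
  refine (Set.ncard_le_ncard (Set.subset_univ _) Set.finite_univ).trans ?_
  simp [Set.ncard_univ]

lemma nup_eq_of_injective {k : ℕ} (h : Fin k → ℕ) {p : ℕ}
    (hinj : Function.Injective fun i => (h i : ZMod p)) : nup h p = k := by
  rw [nup, ← Set.image_univ, Set.ncard_image_of_injective _ hinj]
  simp [Set.ncard_univ]

lemma inv_prime_le_half {p : ℕ} (hp : p.Prime) : 1 / (p : ℝ) ≤ 1 / 2 := by
  have : (2 : ℝ) ≤ p := by exact_mod_cast hp.two_le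
  gcongr

lemma singFactor_nonneg {k : ℕ} (h : Fin k → ℕ) {p : ℕ} (hp : p.Prime) : 0 ≤ singFactor h p := by
  have hp0 : (0 : ℝ) < p := by exact_mod_cast hp.pos
  have h1 : (nup h p : ℝ) / p ≤ 1 := by
    rw [div_le_one hp0]
    exact_mod_cast nup_le_prime h hp
  have h2 := inv_prime_le_half hp
  exact mul_nonneg (by linarith) (zpow_nonneg (by linarith) _)

lemma inv_le_exp_two_mul {x : ℝ} (hx0 : 0 ≤ x) (hx : x ≤ 1 / 2) : (1 - x)⁻¹ ≤ Real.exp (2 * x) := by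
  refine le_trans ?_ (Real.add_one_le_exp (2 * x))
  rw [inv_le_iff_one_le_mul₀ (by linarith)]
  nlinarith

lemma exp_neg_le_one_sub {y : ℝ} (hy : y ≤ 1 / 2) :
    Real.exp (-y - 2 * y ^ 2) ≤ 1 - y := by
  have h1 := Real.add_one_le_exp (y + 2 * y ^ 2)
  have h2 : -y - 2 * y ^ 2 = -(y + 2 * y ^ 2) := by ring
  rw [h2, Real.exp_neg]
  refine inv_le_of_inv_le₀ (by linarith) (le_trans ?_ h1)
  rw [inv_le_iff_one_le_mul₀ (by linarith)]
  nlinarith [mul_nonneg (sq_nonneg y) (by linarith : 0 ≤ 1 - 2 * y)]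

lemma singFactor_le {k : ℕ} (h : Fin k → ℕ) {p : ℕ} (hp : p.Prime) :
    singFactor h p ≤ Real.exp (2 * k * primeDefect h p) := by
  have hp0 : (0 : ℝ) < p := by exact_mod_cast hp.pos
  set x : ℝ := 1 / (p : ℝ) with hx
  have hx0 : 0 ≤ x := by positivity
  have hx2 : x ≤ 1 / 2 := inv_prime_le_half hp
  have hpow : 0 < (1 - x) ^ k := pow_pos (by linarith) k
  rw [singFactor, zpow_neg, zpow_natCast, ← hx]
  by_cases hinj : Function.Injective fun i => (h i : ZMod p)
  · rw [nup_eq_of_injective h hinj]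
    have h1 : 1 + (k : ℝ) * (-x) ≤ (1 + -x) ^ k := one_add_mul_le_pow (by linarith) k
    have h2 : (1 - (k : ℝ) / p) * ((1 - x) ^ k)⁻¹ ≤ 1 := by
      rw [← div_eq_mul_inv, div_le_one hpow]
      have : (k : ℝ) / p = k * x := by rw [hx]; ring
      rw [this]
      calc 1 - k * x = 1 + (k : ℝ) * (-x) := by ring
        _ ≤ _ := h1
        _ = _ := by ring
    refine h2.trans (Real.one_le_exp ?_)
    have := primeDefect_nonneg h p
    positivity
  · simp only [Function.Injective, not_forall] at hinj
    obtain ⟨i, j, heq, hne⟩ := hinj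
    have h1 : x ≤ primeDefect h p := by
      have hdvd : p ∣ ((h i : ℤ) - (h j : ℤ)).natAbs := by
        rw [← Int.natCast_dvd]
        have h2 : (((h i : ℤ) - (h j : ℤ) : ℤ) : ZMod p) = 0 := by
          push_cast
          rw [heq, sub_self]
        exact (ZMod.intCast_zmod_eq_zero_iff_dvd _ _).1 h2
      have h3 := Finset.single_le_sum
        (f := fun q : Fin k × Fin k =>
          if p ∣ ((h q.1 : ℤ) - (h q.2 : ℤ)).natAbs then 1 / (p : ℝ) else 0)
        (s := (Finset.univ : Finset (Fin k)).offDiag) (a := (i, j))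
        (fun q _ => by split_ifs <;> positivity) (by simp [hne])
      simp only [hdvd, if_true] at h3
      exact h3
    have h2 : ((1 - x) ^ k)⁻¹ ≤ Real.exp (2 * k * x) := by
      rw [← inv_pow]
      calc _ ≤ (Real.exp (2 * x)) ^ k :=
            pow_le_pow_left₀ (inv_nonneg.2 (by linarith)) (inv_le_exp_two_mul hx0 hx2) k
        _ = _ := by rw [← Real.exp_nat_mul]; ring_nf
    calc (1 - (nup h p : ℝ) / p) * ((1 - x) ^ k)⁻¹ ≤ 1 * ((1 - x) ^ k)⁻¹ := by
          refine mul_le_mul_of_nonneg_right ?_ (inv_nonneg.2 hpow.le)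
          have : 0 ≤ (nup h p : ℝ) / p := by positivity
          linarith
      _ ≤ Real.exp (2 * k * x) := by rw [one_mul]; exact h2
      _ ≤ _ := Real.exp_le_exp.2 (mul_le_mul_of_nonneg_left h1 (by positivity))

lemma le_singFactor {k : ℕ} (h : Fin k → ℕ) {p : ℕ} (hp : p.Prime) (hpk : 2 * k ≤ p) :
    Real.exp (-(2 * (k : ℝ) ^ 2 * ((p : ℝ) ^ 2)⁻¹)) ≤ singFactor h p := by
  have hp0 : (0 : ℝ) < p := by exact_mod_cast hp.pos
  set x : ℝ := 1 / (p : ℝ) with hx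
  have hx0 : 0 ≤ x := by positivity
  have hx2 : x ≤ 1 / 2 := inv_prime_le_half hp
  have hpow : 0 < (1 - x) ^ k := pow_pos (by linarith) k
  have hkx : (k : ℝ) * x ≤ 1 / 2 := by
    rw [hx, mul_one_div, div_le_iff₀ hp0]
    have : (2 : ℝ) * k ≤ p := by exact_mod_cast hpk
    linarith
  rw [singFactor, zpow_neg, zpow_natCast, ← hx]
  have h1 : Real.exp (k * x) ≤ ((1 - x) ^ k)⁻¹ := by
    rw [Real.exp_nat_mul, ← inv_pow]
    refine pow_le_pow_left₀ (Real.exp_pos _).le ?_ k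
    rw [le_inv_comm₀ (Real.exp_pos _) (by linarith), ← Real.exp_neg]
    linarith [Real.add_one_le_exp (-x)]
  have h2 : Real.exp (-(k * x) - 2 * (k * x) ^ 2) ≤ 1 - (nup h p : ℝ) / p := by
    refine (exp_neg_le_one_sub hkx).trans ?_
    have h3 : (nup h p : ℝ) ≤ k := by exact_mod_cast nup_le h p
    have h4 : (nup h p : ℝ) / p ≤ k / p := by gcongr
    have h5 : (k : ℝ) * x = k / p := by rw [hx]; ring
    linarith
  calc _ = Real.exp (-(k * x) - 2 * (k * x) ^ 2) * Real.exp (k * x) := by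
        rw [← Real.exp_add, hx]
        congr 1
        field_simp
        ring
    _ ≤ _ := mul_le_mul h2 h1 (Real.exp_pos _).le ((Real.exp_pos _).le.trans h2)

lemma primeDefect_eq_zero {k : ℕ} {h : Fin k → ℕ} (hinj : Function.Injective h) {p : ℕ}
    (hp : ∀ i, h i < p) : primeDefect h p = 0 := by
  refine Finset.sum_eq_zero fun q hq => if_neg fun hdvd => ?_
  have hne : h q.1 ≠ h q.2 := hinj.ne (Finset.mem_offDiag.1 hq).2.2
  have h1 := hp q.1
  have h2 := hp q.2
  have := Nat.le_of_dvd (by omega) hdvd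
  omega

lemma partialSeries_nonneg {k : ℕ} (N : ℕ) (h : Fin k → ℕ) : 0 ≤ partialSeries N h :=
  Finset.prod_nonneg fun _ hp => singFactor_nonneg h (mem_primesIoc.1 hp).2

lemma prod_singFactor_le {k : ℕ} (N M : ℕ) (h : Fin k → ℕ) :
    ∏ p ∈ primesIoc N M, singFactor h p ≤ Real.exp (2 * k * tupleRecipSum N M h) := by
  rw [tupleRecipSum_eq_sum_primeDefect, Finset.mul_sum, Real.exp_sum]
  exact Finset.prod_le_prod (fun p hp => singFactor_nonneg h (mem_primesIoc.1 hp).2)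
    fun p hp => singFactor_le h (mem_primesIoc.1 hp).2

lemma le_prod_singFactor {k : ℕ} {N : ℕ} (hN : 2 * k ≤ N) (M : ℕ) (h : Fin k → ℕ) :
    Real.exp (-(2 * (k : ℝ) ^ 2 * (2 / ((N : ℝ) + 1)))) ≤
      ∏ p ∈ primesIoc N M, singFactor h p := by
  calc _ ≤ Real.exp (∑ p ∈ primesIoc N M, -(2 * (k : ℝ) ^ 2 * ((p : ℝ) ^ 2)⁻¹)) := by
        refine Real.exp_le_exp.2 ?_
        rw [Finset.sum_neg_distrib, ← Finset.mul_sum]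
        exact neg_le_neg (mul_le_mul_of_nonneg_left (sum_primesIoc_inv_sq_le N M) (by positivity))
    _ = ∏ p ∈ primesIoc N M, Real.exp (-(2 * (k : ℝ) ^ 2 * ((p : ℝ) ^ 2)⁻¹)) := Real.exp_sum _ _
    _ ≤ _ := Finset.prod_le_prod (fun _ _ => (Real.exp_pos _).le) fun p hp => by
        obtain ⟨⟨h1, _⟩, h2⟩ := mem_primesIoc.1 hp
        exact le_singFactor h h2 (by omega)

lemma multipliable_singFactor {k : ℕ} {h : Fin k → ℕ} (hinj : Function.Injective h) :
    Multipliable fun p : Nat.Primes => singFactor h (p : ℕ) := by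
  have hsum : Summable fun p : Nat.Primes => singFactor h (p : ℕ) - 1 := by
    have hs : Summable fun p : Nat.Primes => 2 * (k : ℝ) ^ 2 * (((p : ℕ) : ℝ) ^ 2)⁻¹ :=
      (((Real.summable_nat_pow_inv (p := 2)).2 (by norm_num)).comp_injective
        (Subtype.val_injective (p := Nat.Prime))).mul_left _
    refine Summable.of_norm_bounded_eventually hs ?_
    have hfin : {p : Nat.Primes | (p : ℕ) ≤ 2 * k + ∑ i, h i}.Finite :=
      (Set.finite_Iic (2 * k + ∑ i, h i)).preimage
        (Subtype.val_injective (p := Nat.Prime)).injOn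
    filter_upwards [hfin.compl_mem_cofinite] with p hp
    simp only [Set.mem_compl_iff, Set.mem_ofPred_eq, not_le] at hp
    have h0 : primeDefect h (p : ℕ) = 0 := by
      refine primeDefect_eq_zero hinj fun i => ?_
      have := Finset.single_le_sum (f := h) (fun _ _ => Nat.zero_le _) (Finset.mem_univ i)
      omega
    have h1 := singFactor_le h p.2
    have h2 := le_singFactor h p.2 (by omega)
    rw [h0, mul_zero, Real.exp_zero] at h1
    have h3 := Real.add_one_le_exp (-(2 * (k : ℝ) ^ 2 * (((p : ℕ) : ℝ) ^ 2)⁻¹))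
    rw [Real.norm_eq_abs, abs_le]
    constructor <;> linarith
  simpa using Real.multipliable_one_add_of_summable hsum

lemma tendsto_partialSeries {k : ℕ} {h : Fin k → ℕ} (hinj : Function.Injective h) :
    Tendsto (fun N => partialSeries N h) atTop (𝓝 (singSeries h)) := by
  have h1 : Tendsto (fun N : ℕ => ((primesIoc 0 N).subtype Nat.Prime : Finset Nat.Primes))
      atTop atTop := by
    refine tendsto_atTop_finset_of_monotone ?_ ?_
    · intro N M hNM p hp
      rw [Finset.mem_subtype, mem_primesIoc] at hp ⊢
      exact ⟨⟨hp.1.1, hp.1.2.trans hNM⟩, hp.2⟩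
    · intro p
      refine ⟨(p : ℕ), ?_⟩
      rw [Finset.mem_subtype, mem_primesIoc]
      exact ⟨⟨p.2.pos, le_rfl⟩, p.2⟩
  refine ((multipliable_singFactor hinj).hasProd.comp h1).congr fun N => ?_
  exact Finset.prod_subtype_of_mem (f := fun p => singFactor h p)
    fun p hp => (mem_primesIoc.1 hp).2

/-! ### Comparison of truncations -/

lemma abs_rpow_sub_one_le {m a t : ℝ} (hm : 0 ≤ m) (h1 : Real.exp (-a) ≤ t)
    (h2 : t ≤ Real.exp a) : |t ^ m - 1| ≤ Real.exp (m * a) - 1 := by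
  have ht : 0 ≤ t := (Real.exp_pos _).le.trans h1
  have h3 := Real.rpow_le_rpow (Real.exp_pos _).le h1 hm
  have h4 := Real.rpow_le_rpow ht h2 hm
  rw [← Real.exp_mul] at h3 h4
  have h5 : Real.exp (-a * m) + Real.exp (m * a) ≥ 2 := by
    have h6 : Real.exp (-a * m) * Real.exp (m * a) = 1 := by
      rw [← Real.exp_add]; ring_nf; simp
    nlinarith [sq_nonneg (Real.exp (-a * m) - Real.exp (m * a)), Real.exp_pos (-a * m),
      Real.exp_pos (m * a)]
  rw [mul_comm a m] at h4
  rw [abs_le]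
  constructor <;> linarith

lemma abs_truncPow_sub_le {k : ℕ} {m : ℝ} (hm : 0 ≤ m) {N M : ℕ} (hN : 2 * k ≤ N) (hNM : N ≤ M)
    (h : Fin k → ℕ) :
    |truncPow m (partialSeries M h) - truncPow m (partialSeries N h)| ≤
      Real.exp (2 * k * m * tupleRecipSum 0 M h) *
        (Real.exp (m * (2 * (k : ℝ) ^ 2 * (2 / ((N : ℝ) + 1)) + 2 * k * tupleRecipSum N M h)) -
          1) := by
  set a : ℝ := 2 * (k : ℝ) ^ 2 * (2 / ((N : ℝ) + 1)) with ha
  set b : ℝ := 2 * k * tupleRecipSum N M h with hb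
  have ha0 : 0 ≤ a := by positivity
  have hΩ := tupleRecipSum_nonneg N M h
  have hb0 : 0 ≤ b := by positivity
  set t := ∏ p ∈ primesIoc N M, singFactor h p with ht
  have hmul : partialSeries M h = partialSeries N h * t := (prod_primesIoc_mul hNM _).symm
  have ht1 : Real.exp (-(a + b)) ≤ t :=
    (Real.exp_le_exp.2 (by linarith)).trans (le_prod_singFactor hN M h)
  have ht2 : t ≤ Real.exp (a + b) :=
    (prod_singFactor_le N M h).trans (Real.exp_le_exp.2 (by linarith))
  have ht0 : 0 < t := (Real.exp_pos _).trans_le ht1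
  have hrhs : 0 ≤ Real.exp (m * (a + b)) - 1 := by
    have : 0 ≤ m * (a + b) := by positivity
    linarith [Real.add_one_le_exp (m * (a + b))]
  rw [hmul]
  have hP0 := partialSeries_nonneg N h
  rcases hP0.eq_or_lt' with h0 | hP
  · rw [h0]
    simp only [truncPow, zero_mul, if_true, sub_zero, abs_zero]
    positivity
  · rw [truncPow, truncPow, if_neg (mul_pos hP ht0).ne', if_neg hP.ne',
      Real.mul_rpow hP0 ht0.le]
    have hfac : partialSeries N h ^ m * t ^ m - partialSeries N h ^ m =
        partialSeries N h ^ m * (t ^ m - 1) := by ring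
    rw [hfac, abs_mul, abs_of_nonneg (Real.rpow_nonneg hP0 m)]
    refine mul_le_mul ?_ (abs_rpow_sub_one_le hm ht1 ht2) (abs_nonneg _) (Real.exp_pos _).le
    have hmono : tupleRecipSum 0 N h ≤ tupleRecipSum 0 M h := by
      rw [tupleRecipSum_eq_sum_primeDefect, tupleRecipSum_eq_sum_primeDefect]
      refine Finset.sum_le_sum_of_subset_of_nonneg (fun p hp => ?_)
        fun _ _ _ => primeDefect_nonneg _ _
      rw [mem_primesIoc] at hp ⊢
      exact ⟨⟨hp.1.1, hp.1.2.trans hNM⟩, hp.2⟩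
    have h1 := Real.rpow_le_rpow hP0 (prod_singFactor_le 0 N h) hm
    refine h1.trans ?_
    rw [← Real.exp_mul]
    refine Real.exp_le_exp.2 ?_
    calc _ = 2 * k * m * tupleRecipSum 0 N h := by ring
      _ ≤ _ := mul_le_mul_of_nonneg_left hmono (by positivity)

lemma card_distinctTuples_le (k H : ℕ) : ((distinctTuples k H).card : ℝ) ≤ (H : ℝ) ^ k := by
  have h1 := Finset.card_filter_le (Fintype.piFinset fun _ : Fin k => Finset.Icc 1 H)
    Function.Injective
  rw [Fintype.card_piFinset] at h1
  simp only [Nat.card_Icc, Nat.add_sub_cancel, Finset.prod_const, Finset.card_univ,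
    Fintype.card_fin] at h1
  exact_mod_cast h1

lemma mul_sub_one_le {δ X Y : ℝ} (hδ : 0 < δ) (hY : 1 ≤ Y) :
    X * (Y - 1) ≤ δ * X ^ 2 + δ⁻¹ * (Y ^ 2 - 1) := by
  have h1 : 0 < δ⁻¹ := inv_pos.2 hδ
  have h2 : δ * δ⁻¹ = 1 := mul_inv_cancel₀ hδ.ne'
  have h3 : δ⁻¹ * (Y - 1) ^ 2 ≤ δ⁻¹ * (Y ^ 2 - 1) := by
    refine mul_le_mul_of_nonneg_left ?_ h1.le
    nlinarith
  have h4 : 0 ≤ δ * (X - δ⁻¹ * (Y - 1)) ^ 2 := by positivity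
  have h5 : δ * (X - δ⁻¹ * (Y - 1)) ^ 2 =
      δ * X ^ 2 - 2 * (δ * δ⁻¹) * X * (Y - 1) + (δ * δ⁻¹) * δ⁻¹ * (Y - 1) ^ 2 := by ring
  rw [h5, h2] at h4
  have h6 : 0 ≤ δ * X ^ 2 := by positivity
  have h7 : 0 ≤ δ⁻¹ * (Y - 1) ^ 2 := by positivity
  linarith

lemma sum_abs_truncPow_sub_le (k : ℕ) {m : ℝ} (hm : 0 ≤ m) {ε : ℝ} (hε : 0 < ε) :
    ∃ N₀ : ℕ, ∀ N, N₀ ≤ N → ∀ M, N ≤ M → ∀ H : ℕ,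
      ∑ h ∈ distinctTuples k H,
        |truncPow m (partialSeries M h) - truncPow m (partialSeries N h)| ≤
          ε * (H : ℝ) ^ k := by
  set B : ℝ := 4 * k * m with hB
  have hB0 : 0 ≤ B := by positivity
  obtain ⟨C, hC0, hC⟩ := sum_distinctTuples_exp_sub_one_le k hB0
  set D : ℕ → ℝ := fun N => C * (Real.exp (C * (2 / ((N : ℝ) + 1))) - 1) with hD
  have hD0 : 0 ≤ D 0 := by
    have : 0 ≤ C * (2 / (((0 : ℕ) : ℝ) + 1)) := by positivity
    exact mul_nonneg hC0 (by linarith [Real.add_one_le_exp (C * (2 / (((0 : ℕ) : ℝ) + 1)))])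
  set E : ℕ → ℝ := fun N => Real.exp (2 * m * (2 * (k : ℝ) ^ 2 * (2 / ((N : ℝ) + 1)))) with hE
  have hlim : Tendsto (fun N : ℕ => 2 / ((N : ℝ) + 1)) atTop (𝓝 0) := by
    have := (tendsto_one_div_add_atTop_nhds_zero_nat (𝕜 := ℝ)).const_mul 2
    simpa only [mul_one_div, mul_zero] using this
  have hDlim : Tendsto D atTop (𝓝 0) := by
    have := ((Real.continuous_exp.tendsto _).comp (hlim.const_mul C)).sub_const 1 |>.const_mul C
    simpa [hD, Function.comp_def] using this
  have hElim : Tendsto E atTop (𝓝 1) := by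
    have := (Real.continuous_exp.tendsto _).comp
      ((hlim.const_mul (2 * (k : ℝ) ^ 2)).const_mul (2 * m))
    simpa [hE, Function.comp_def] using this
  set δ : ℝ := ε / (2 * (D 0 + 1)) with hδ
  have hδ0 : 0 < δ := by positivity
  have hlim2 : Tendsto (fun N => δ⁻¹ * (E N * D N + (E N - 1))) atTop (𝓝 0) := by
    have := ((hElim.mul hDlim).add (hElim.sub_const 1)).const_mul δ⁻¹
    simpa using this
  obtain ⟨N₁, hN₁⟩ := eventually_atTop.1 (hlim2.eventually_lt_const (half_pos hε))
  refine ⟨max N₁ (2 * k), fun N hN M hNM H => ?_⟩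
  have hsmall := hN₁ N ((le_max_left _ _).trans hN)
  have hNk : 2 * k ≤ N := (le_max_right _ _).trans hN
  have hpt : ∀ h ∈ distinctTuples k H,
      |truncPow m (partialSeries M h) - truncPow m (partialSeries N h)| ≤
        δ * ((Real.exp (B * tupleRecipSum 0 M h) - 1) + 1) +
          δ⁻¹ * (E N * (Real.exp (B * tupleRecipSum N M h) - 1) + (E N - 1)) := by
    intro h _
    refine (abs_truncPow_sub_le hm hNk hNM h).trans ?_
    refine (mul_sub_one_le hδ0 ?_).trans (le_of_eq ?_)
    · have := tupleRecipSum_nonneg N M h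
      exact Real.one_le_exp (by positivity)
    · have h1 : Real.exp (2 * k * m * tupleRecipSum 0 M h) ^ 2 =
          Real.exp (B * tupleRecipSum 0 M h) := by
        rw [← Real.exp_nat_mul, hB]; congr 1; push_cast; ring
      have h2 : Real.exp (m * (2 * (k : ℝ) ^ 2 * (2 / ((N : ℝ) + 1)) +
          2 * k * tupleRecipSum N M h)) ^ 2 = E N * Real.exp (B * tupleRecipSum N M h) := by
        rw [← Real.exp_nat_mul, hB, ← Real.exp_add]; congr 1; push_cast; ring
      rw [h1, h2]
      ring
  have hE1 : 1 ≤ E N := Real.one_le_exp (by positivity)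
  have hHk : 0 ≤ (H : ℝ) ^ k := by positivity
  have hcard := card_distinctTuples_le k H
  calc _ ≤ ∑ h ∈ distinctTuples k H, (δ * ((Real.exp (B * tupleRecipSum 0 M h) - 1) + 1) +
          δ⁻¹ * (E N * (Real.exp (B * tupleRecipSum N M h) - 1) + (E N - 1))) :=
        Finset.sum_le_sum hpt
    _ = δ * (∑ h ∈ distinctTuples k H, (Real.exp (B * tupleRecipSum 0 M h) - 1) +
          (distinctTuples k H).card) +
        δ⁻¹ * (E N * ∑ h ∈ distinctTuples k H, (Real.exp (B * tupleRecipSum N M h) - 1) +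
          (distinctTuples k H).card * (E N - 1)) := by
        rw [Finset.sum_add_distrib, ← Finset.mul_sum, ← Finset.mul_sum, Finset.sum_add_distrib,
          Finset.sum_add_distrib, ← Finset.mul_sum]
        simp only [Finset.sum_const, nsmul_eq_mul, mul_one]
    _ ≤ δ * (D 0 * (H : ℝ) ^ k + (H : ℝ) ^ k) +
        δ⁻¹ * (E N * (D N * (H : ℝ) ^ k) + (H : ℝ) ^ k * (E N - 1)) := by
        have h1 := hC 0 M H
        have h2 := hC N M H
        have h3 : 0 ≤ E N - 1 := by linarith
        gcongr
    _ = (δ * (D 0 + 1) + δ⁻¹ * (E N * D N + (E N - 1))) * (H : ℝ) ^ k := by ring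
    _ ≤ (ε / 2 + ε / 2) * (H : ℝ) ^ k := by
        refine mul_le_mul_of_nonneg_right (add_le_add (le_of_eq ?_) hsmall.le) hHk
        rw [hδ]; field_simp
    _ = _ := by ring

lemma tendsto_truncPow_partialSeries {k : ℕ} (m : ℝ) {h : Fin k → ℕ}
    (hinj : Function.Injective h) :
    Tendsto (fun M => truncPow m (partialSeries M h)) atTop (𝓝 (truncPow m (singSeries h))) := by
  have hlim := tendsto_partialSeries hinj
  by_cases h0 : singSeries h = 0
  · have hzero : partialSeries (2 * k) h = 0 := by
      set e := Real.exp (-(2 * (k : ℝ) ^ 2 * (2 / (((2 * k : ℕ) : ℝ) + 1)))) with he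
      have h1 : ∀ᶠ M in atTop, partialSeries (2 * k) h * e ≤ partialSeries M h := by
        filter_upwards [eventually_ge_atTop (2 * k)] with M hM
        rw [partialSeries, partialSeries, ← prod_primesIoc_mul hM]
        exact mul_le_mul_of_nonneg_left (le_prod_singFactor le_rfl M h)
          (partialSeries_nonneg (2 * k) h)
      have h2 := ge_of_tendsto hlim h1
      rw [h0] at h2
      have h3 : 0 < e := Real.exp_pos _
      nlinarith [partialSeries_nonneg (2 * k) h]
    refine tendsto_const_nhds.congr' ?_
    filter_upwards [eventually_ge_atTop (2 * k)] with M hM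
    have h1 : partialSeries M h = 0 := by
      have h2 := prod_primesIoc_mul hM (fun p => singFactor h p)
      rw [partialSeries] at hzero ⊢
      rw [← h2, hzero, zero_mul]
    rw [h1, h0]
  · have h1 : ∀ᶠ M in atTop, partialSeries M h ≠ 0 := hlim.eventually_ne h0
    have h2 := hlim.rpow_const (p := m) (Or.inl h0)
    rw [truncPow, if_neg h0]
    refine h2.congr' ?_
    filter_upwards [h1] with M hM
    rw [truncPow, if_neg hM]

/-! ### Averages of periodic functions -/

lemma tendsto_card_mod_div (Q r : ℕ) (hr : r < Q) :
    Tendsto (fun H : ℕ => (((Finset.Icc 1 H).filter fun n => n % Q = r).card : ℝ) / H) atTop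
      (𝓝 (1 / Q)) := by
  have hQ : 0 < Q := by omega
  have hQ0 : (0 : ℝ) < Q := by exact_mod_cast hQ
  have hcount : ∀ H : ℕ,
      |(((Finset.Icc 1 H).filter fun n => n % Q = r).card : ℝ) - (H : ℝ) / Q| ≤ 1 := by
    intro H
    have h1 := Nat.Ioc_filter_modEq_card 0 H hQ r
    have h2 : ((Finset.Icc 1 H).filter fun n => n % Q = r) =
        (Finset.Ioc 0 H).filter fun n => n ≡ r [MOD Q] := by
      ext n
      simp only [Finset.mem_filter, Finset.mem_Icc, Finset.mem_Ioc, Nat.ModEq,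
        Nat.mod_eq_of_lt hr]
      rfl
    rw [← h2] at h1
    set c := ((Finset.Icc 1 H).filter fun n => n % Q = r).card
    have h3 : (c : ℚ) = max ((⌊((H : ℚ) - r) / Q⌋ : ℚ) - ⌊(((0 : ℕ) : ℚ) - r) / Q⌋) 0 := by
      exact_mod_cast h1
    have huv : ((H : ℚ) - r) / Q - (((0 : ℕ) : ℚ) - r) / Q = H / Q := by
      rw [← sub_div]; congr 1; push_cast; ring
    have hu1 := Int.floor_le (((H : ℚ) - r) / Q)
    have hu2 := Int.lt_floor_add_one (((H : ℚ) - r) / Q)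
    have hv1 := Int.floor_le ((((0 : ℕ) : ℚ) - r) / Q)
    have hv2 := Int.lt_floor_add_one ((((0 : ℕ) : ℚ) - r) / Q)
    have hnn : (0 : ℚ) ≤ H / Q := by positivity
    have h4 : |(c : ℚ) - (H : ℚ) / Q| ≤ 1 := by
      rw [h3, abs_le]
      constructor
      · have := le_max_left ((⌊((H : ℚ) - r) / Q⌋ : ℚ) - ⌊(((0 : ℕ) : ℚ) - r) / Q⌋) 0
        linarith
      · rw [sub_le_iff_le_add]
        exact max_le (by linarith) (by linarith)
    have h5 : ((|(c : ℚ) - (H : ℚ) / Q| : ℚ) : ℝ) ≤ ((1 : ℚ) : ℝ) := Rat.cast_le.2 h4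
    push_cast at h5
    exact h5
  rw [tendsto_iff_norm_sub_tendsto_zero]
  refine squeeze_zero' (Eventually.of_forall fun _ => norm_nonneg _) ?_
    (tendsto_one_div_atTop_nhds_zero_nat (𝕜 := ℝ))
  filter_upwards [eventually_gt_atTop 0] with H hH
  have hH0 : (0 : ℝ) < H := by exact_mod_cast hH
  have h5 : ((((Finset.Icc 1 H).filter fun n => n % Q = r).card : ℝ) / H - 1 / Q) =
      ((((Finset.Icc 1 H).filter fun n => n % Q = r).card : ℝ) - (H : ℝ) / Q) / H := by
    field_simp
  rw [h5, Real.norm_eq_abs, abs_div, abs_of_pos hH0]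
  gcongr
  exact hcount H

lemma exists_tendsto_average_periodic {k Q : ℕ} (hQ : 0 < Q) (G : (Fin k → ℕ) → ℝ)
    (hG : ∀ h, G (fun i => h i % Q) = G h) :
    ∃ L : ℝ, Tendsto (fun H : ℕ =>
      (∑ h ∈ Fintype.piFinset (fun _ : Fin k => Finset.Icc 1 H), G h) / (H : ℝ) ^ k)
        atTop (𝓝 L) := by
  set R := Fintype.piFinset fun _ : Fin k => Finset.range Q with hR
  have key : ∀ H : ℕ,
      (∑ h ∈ Fintype.piFinset (fun _ : Fin k => Finset.Icc 1 H), G h) / (H : ℝ) ^ k =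
        ∑ r ∈ R, G r * ∏ i, ((((Finset.Icc 1 H).filter fun n => n % Q = r i).card : ℝ) / H) := by
    intro H
    have hmaps : ∀ h ∈ Fintype.piFinset (fun _ : Fin k => Finset.Icc 1 H),
        (fun i => h i % Q) ∈ R := by
      intro h _
      rw [hR, Fintype.mem_piFinset]
      exact fun i => Finset.mem_range.2 (Nat.mod_lt _ hQ)
    rw [← Finset.sum_fiberwise_of_maps_to hmaps, Finset.sum_div]
    refine Finset.sum_congr rfl fun r _ => ?_
    have h1 : ((Fintype.piFinset (fun _ : Fin k => Finset.Icc 1 H)).filter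
        fun h => (fun i => h i % Q) = r) =
          Fintype.piFinset fun i => (Finset.Icc 1 H).filter fun n => n % Q = r i := by
      ext h
      simp only [Finset.mem_filter, Fintype.mem_piFinset, funext_iff]
      exact forall_and.symm
    have h2 : ∑ h ∈ Fintype.piFinset (fun _ : Fin k => Finset.Icc 1 H) with
        (fun i => h i % Q) = r, G h = (∏ i, (((Finset.Icc 1 H).filter
          fun n => n % Q = r i).card : ℝ)) * G r := by
      rw [← Nat.cast_prod, ← Fintype.card_piFinset, ← h1, ← nsmul_eq_mul, ← Finset.sum_const]
      refine Finset.sum_congr rfl fun h hh => ?_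
      rw [← hG h, (Finset.mem_filter.1 hh).2]
    rw [h2, Finset.prod_div_distrib]
    simp only [Finset.prod_const, Finset.card_univ, Fintype.card_fin]
    ring
  simp_rw [key]
  refine ⟨_, tendsto_finsetSum _ fun r hr => Tendsto.const_mul _ (tendsto_finsetProd _
    fun i _ => tendsto_card_mod_div Q (r i) ?_)⟩
  exact Finset.mem_range.1 (Fintype.mem_piFinset.1 hr i)

lemma tendsto_card_nondistinct_div (k : ℕ) :
    Tendsto (fun H : ℕ => (((Fintype.piFinset fun _ : Fin k => Finset.Icc 1 H).filter
      fun h => ¬ Function.Injective h).card : ℝ) / (H : ℝ) ^ k) atTop (𝓝 0) := by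
  set Q := (Finset.univ : Finset (Fin k)).offDiag with hQ
  have hlim : Tendsto (fun H : ℕ => (Q.card : ℝ) / (H : ℝ)) atTop (𝓝 0) :=
    tendsto_const_div_atTop_nhds_zero_nat _
  refine squeeze_zero' (Eventually.of_forall fun H => by positivity) ?_ hlim
  filter_upwards [eventually_gt_atTop 0] with H hH
  have hH0 : (0 : ℝ) < H := by exact_mod_cast hH
  rw [div_le_div_iff₀ (by positivity) hH0]
  set Φ : ℕ → ℕ → ℝ := fun a b => if a = b then 1 else 0 with hΦ
  have hΦ0 : ∀ a b, 0 ≤ Φ a b := fun a b => by simp only [hΦ]; split_ifs <;> norm_num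
  have hpair : ∀ q ∈ Q, (∑ h ∈ Fintype.piFinset (fun _ : Fin k => Finset.Icc 1 H),
      Φ (h q.1) (h q.2)) * H ≤ (H : ℝ) ^ k := by
    intro q hq
    have h1 := sum_piFinset_pair_le (Finset.Icc 1 H) q.1 q.2 (Finset.mem_offDiag.1 hq).2.2 Φ hΦ0
    have h2 : ∑ a ∈ Finset.Icc 1 H, ∑ b ∈ Finset.Icc 1 H, Φ a b = H := by
      have h3 : ∀ a ∈ Finset.Icc 1 H, ∑ b ∈ Finset.Icc 1 H, Φ a b = 1 := by
        intro a ha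
        simp only [hΦ, Finset.sum_ite_eq, if_pos ha]
      rw [Finset.sum_congr rfl h3]
      simp
    rw [h2] at h1
    simp only [Nat.card_Icc, Nat.add_sub_cancel] at h1
    refine le_of_mul_le_mul_left (le_trans (le_of_eq ?_) (h1.trans (le_of_eq ?_))) hH0
    · ring
    · ring
  have hcard : (((Fintype.piFinset fun _ : Fin k => Finset.Icc 1 H).filter
      fun h => ¬ Function.Injective h).card : ℝ) ≤
        ∑ q ∈ Q, ∑ h ∈ Fintype.piFinset (fun _ : Fin k => Finset.Icc 1 H),
          Φ (h q.1) (h q.2) := by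
    rw [Finset.sum_comm, Finset.card_eq_sum_ones, Nat.cast_sum]
    refine le_trans ?_ (Finset.sum_le_sum_of_subset_of_nonneg
      (Finset.filter_subset (fun h : Fin k → ℕ => ¬ Function.Injective h) _) fun _ _ _ => Finset.sum_nonneg fun _ _ => hΦ0 _ _)
    refine Finset.sum_le_sum fun h hh => ?_
    have hni := (Finset.mem_filter.1 hh).2
    simp only [Function.Injective, not_forall] at hni
    obtain ⟨i, j, heq, hne⟩ := hni
    have h3 := Finset.single_le_sum (f := fun q : Fin k × Fin k => Φ (h q.1) (h q.2))
      (s := Q) (a := (i, j)) (fun q _ => hΦ0 _ _) (by simp [hQ, hne])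
    simpa [hΦ, heq] using h3
  calc _ ≤ (∑ q ∈ Q, ∑ h ∈ Fintype.piFinset (fun _ : Fin k => Finset.Icc 1 H),
          Φ (h q.1) (h q.2)) * H := mul_le_mul_of_nonneg_right hcard hH0.le
    _ ≤ ∑ q ∈ Q, (H : ℝ) ^ k := by
        rw [Finset.sum_mul]
        exact Finset.sum_le_sum hpair
    _ = _ := by simp

lemma exists_tendsto_average_partialSeries (k N : ℕ) (m : ℝ) :
    ∃ L : ℝ, Tendsto (fun H : ℕ =>
      (∑ h ∈ distinctTuples k H, truncPow m (partialSeries N h)) / (H : ℝ) ^ k)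
        atTop (𝓝 L) := by
  set G : (Fin k → ℕ) → ℝ := fun h => truncPow m (partialSeries N h) with hGdef
  set Q := ∏ p ∈ primesIoc 0 N, p with hQdef
  have hQ : 0 < Q := Finset.prod_pos fun p hp => (mem_primesIoc.1 hp).2.pos
  have hG : ∀ h, G (fun i => h i % Q) = G h := by
    intro h
    simp only [hGdef, partialSeries]
    congr 1
    refine Finset.prod_congr rfl fun p hp => ?_
    have hdvd : p ∣ Q := Finset.dvd_prod_of_mem _ hp
    have hcast : ∀ i, ((h i % Q : ℕ) : ZMod p) = (h i : ZMod p) := by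
      intro i
      rw [ZMod.natCast_eq_natCast_iff', Nat.mod_mod_of_dvd _ hdvd]
    simp only [singFactor, nup, hcast]
  obtain ⟨L, hL⟩ := exists_tendsto_average_periodic hQ G hG
  obtain ⟨K, hK⟩ : ∃ K : ℝ, ∀ h, |G h| ≤ K := by
    refine ⟨∑ r ∈ Fintype.piFinset (fun _ : Fin k => Finset.range Q), |G r|, fun h => ?_⟩
    rw [← hG h]
    refine Finset.single_le_sum (f := fun r => |G r|) (fun _ _ => abs_nonneg _) ?_
    rw [Fintype.mem_piFinset]
    exact fun i => Finset.mem_range.2 (Nat.mod_lt _ hQ)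
  have hdiff : Tendsto (fun H : ℕ => (∑ h ∈ (Fintype.piFinset fun _ : Fin k =>
      Finset.Icc 1 H).filter fun h : Fin k → ℕ => ¬ Function.Injective h, G h) / (H : ℝ) ^ k)
        atTop (𝓝 0) := by
    have h1 := (tendsto_card_nondistinct_div k).mul_const K
    rw [zero_mul] at h1
    refine squeeze_zero_norm (fun H => ?_) h1
    rw [norm_div, Real.norm_eq_abs, Real.norm_of_nonneg (by positivity), div_mul_eq_mul_div]
    gcongr
    refine (Finset.abs_sum_le_sum_abs _ _).trans ?_
    rw [← nsmul_eq_mul]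
    exact Finset.sum_le_card_nsmul _ _ _ fun h _ => hK h
  refine ⟨L, ?_⟩
  have h2 := hL.sub hdiff
  rw [sub_zero] at h2
  refine h2.congr fun H => ?_
  rw [← sub_div, ← Finset.sum_filter_add_sum_filter_not
    (Fintype.piFinset fun _ : Fin k => Finset.Icc 1 H) (fun h : Fin k → ℕ => Function.Injective h) G]
  simp only [add_sub_cancel_right]
  rfl

open Classical in
/-- For every fixed `k ≥ 1` and every real `m ≥ 0` there exists `μ_k(m)` such that the
average of `S(h)^m` over `k`-tuples of distinct positive integers with entries at most
`H` tends to `μ_k(m)`; here `S(h)^m` is interpreted as `0` whenever `S(h) = 0`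
(in particular also for `m = 0`). -/
theorem moments_exist (k : ℕ) (hk : 1 ≤ k) (m : ℝ) (hm : 0 ≤ m) :
    ∃ μ : ℝ,
      Tendsto
        (fun H : ℕ =>
          (∑ h ∈ distinctTuples k H,
            (if singSeries h = 0 then (0 : ℝ) else singSeries h ^ m)) / (H : ℝ) ^ k)
        atTop (𝓝 μ) := by
  set A : ℕ → ℝ := fun H =>
    (∑ h ∈ distinctTuples k H, truncPow m (singSeries h)) / (H : ℝ) ^ k with hA
  have hclose : ∀ ε : ℝ, 0 < ε → ∃ N : ℕ, ∀ H : ℕ, 0 < H →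
      |A H - (∑ h ∈ distinctTuples k H, truncPow m (partialSeries N h)) / (H : ℝ) ^ k| ≤ ε := by
    intro ε hε
    obtain ⟨N, hN⟩ := sum_abs_truncPow_sub_le k hm hε
    refine ⟨N, fun H hH => ?_⟩
    have hHk : (0 : ℝ) < (H : ℝ) ^ k := by positivity
    rw [hA, ← sub_div, abs_div, abs_of_pos hHk, div_le_iff₀ hHk, ← Finset.sum_sub_distrib]
    refine (Finset.abs_sum_le_sum_abs _ _).trans ?_
    have hlim : Tendsto (fun M => ∑ h ∈ distinctTuples k H,
        |truncPow m (partialSeries M h) - truncPow m (partialSeries N h)|) atTop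
          (𝓝 (∑ h ∈ distinctTuples k H,
            |truncPow m (singSeries h) - truncPow m (partialSeries N h)|)) :=
      tendsto_finsetSum _ fun h hh =>
        ((tendsto_truncPow_partialSeries m (Finset.mem_filter.1 hh).2).sub_const _).abs
    refine le_of_tendsto hlim ?_
    filter_upwards [eventually_ge_atTop N] with M hM
    exact hN N le_rfl M hM H
  have hcauchy : CauchySeq A := by
    rw [Metric.cauchySeq_iff]
    intro ε hε
    obtain ⟨N, hN⟩ := hclose (ε / 4) (by linarith)
    obtain ⟨L, hL⟩ := exists_tendsto_average_partialSeries k N m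
    obtain ⟨H₀, hH₀⟩ := Metric.cauchySeq_iff.1 hL.cauchySeq (ε / 4) (by linarith)
    refine ⟨max H₀ 1, fun H hH H' hH' => ?_⟩
    have h1 := hN H (lt_of_lt_of_le one_pos ((le_max_right _ _).trans hH))
    have h2 := hN H' (lt_of_lt_of_le one_pos ((le_max_right _ _).trans hH'))
    have h3 := hH₀ H ((le_max_left _ _).trans hH) H' ((le_max_left _ _).trans hH')
    rw [Real.dist_eq, abs_lt] at h3 ⊢
    rw [abs_le] at h1 h2
    constructor <;> linarith
  obtain ⟨μ, hμ⟩ := cauchySeq_tendsto_of_complete hcauchy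
  refine ⟨μ, hμ.congr fun H => ?_⟩
  simp only [hA, truncPow]
end

section
/- For all fixed integers k ≥ 1 and m ≥ 1, the Euler product μ_k(m) = ∏_p (1 − 1/p)^{−km} · (p^{−k} Σ_{u ∈ (ℤ/pℤ)^k} (1 − ρ_p(u)/p)^m) over all primes converges absolutely, and lim_{h→∞} h^{−k} · Σ* S(h)^m = μ_k(m), where the sum Σ* runs over all k-tuples h = (h_1,…,h_k) of distinct positive integers with h_i ≤ h for all i. -/
open Filter Topology

/-- `p^(-k) * Σ_{u ∈ (ℤ/p)^k} (1 - ρ_p(u)/p)^m`, where `ρ_p(u)` is the number of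
distinct components of `u`. -/
noncomputable def halfTerm (k m : ℕ) (p : Nat.Primes) : ℝ :=
  haveI : NeZero (p : ℕ) := ⟨p.2.ne_zero⟩
  ((p : ℕ) : ℝ) ^ (-(k : ℤ)) *
    ∑ u : Fin k → ZMod (p : ℕ), (1 - ((Set.range u).ncard : ℝ) / ((p : ℕ) : ℝ)) ^ m

/-- The `p`-factor `(1 - 1/p)^(-km) * (p^(-k) Σ_u (1 - ρ_p(u)/p)^m)` of `μ_k(m)`. -/
noncomputable def muFactor (k m : ℕ) (p : Nat.Primes) : ℝ :=
  (1 - 1 / ((p : ℕ) : ℝ)) ^ (-((k * m : ℕ) : ℤ)) * halfTerm k m p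

/-- `μ_k(m)`, the Euler product over all primes. -/
noncomputable def muMoment (k m : ℕ) : ℝ :=
  ∏' p : Nat.Primes, muFactor k m p

lemma exists_abs_one_sub_mul_pow_sub_le (a : ℝ) (n : ℕ) :
    ∃ C, 0 ≤ C ∧ ∀ x : ℝ, 0 ≤ x → x ≤ 1 → |(1 - a * x) ^ n - (1 - n * a * x)| ≤ C * x ^ 2 := by
  induction n with
  | zero => exact ⟨0, le_rfl, fun x _ _ => by simp⟩
  | succ n ih =>
    obtain ⟨C, hC, h⟩ := ih
    refine ⟨(1 + |a|) * C + n * a ^ 2, by positivity, fun x hx hx1 => ?_⟩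
    have h1 : |1 - a * x| ≤ 1 + |a| := by
      refine (abs_sub _ _).trans ?_
      rw [abs_one, abs_mul, abs_of_nonneg hx]
      nlinarith [abs_nonneg a]
    calc |(1 - a * x) ^ (n + 1) - (1 - (n + 1 : ℕ) * a * x)|
        = |(1 - a * x) * ((1 - a * x) ^ n - (1 - n * a * x)) + n * a ^ 2 * x ^ 2| := by
          congr 1; push_cast; ring
      _ ≤ |1 - a * x| * |(1 - a * x) ^ n - (1 - n * a * x)| + n * a ^ 2 * x ^ 2 := by
          refine (abs_add_le _ _).trans ?_
          rw [abs_mul, abs_of_nonneg (show (0 : ℝ) ≤ n * a ^ 2 * x ^ 2 by positivity)]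
      _ ≤ (1 + |a|) * (C * x ^ 2) + n * a ^ 2 * x ^ 2 := by
          gcongr
          exact h x hx hx1
      _ = _ := by ring

lemma exists_abs_local_factor_sub_one_le (k m : ℕ) (ν : ℝ) (hν : ν ≤ k) :
    ∃ C, 0 ≤ C ∧ ∀ x : ℝ, 0 ≤ x → x ≤ 1 / 2 →
      |((1 - ν * x) * (1 - x) ^ (-(k : ℤ))) ^ m - 1| ≤ C * (x ^ 2 + (k - ν) * x) := by
  obtain ⟨C₁, hC₁, h₁⟩ := exists_abs_one_sub_mul_pow_sub_le ν m
  obtain ⟨C₂, hC₂, h₂⟩ := exists_abs_one_sub_mul_pow_sub_le 1 (k * m)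
  refine ⟨2 ^ (k * m) * (C₁ + C₂ + m), by positivity, fun x hx hx2 => ?_⟩
  have hpos : 0 < (1 - x) ^ (k * m) := by apply pow_pos; linarith
  have hkν : 0 ≤ (k - ν) * x := mul_nonneg (by linarith) hx
  have hfac : ((1 - ν * x) * (1 - x) ^ (-(k : ℤ))) ^ m - 1 =
      ((1 - ν * x) ^ m - (1 - x) ^ (k * m)) * ((1 - x) ^ (k * m))⁻¹ := by
    rw [sub_mul (_ ^ m), mul_inv_cancel₀ hpos.ne', mul_pow, zpow_neg, zpow_natCast, inv_pow,
      pow_mul]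
  have hinv : ((1 - x) ^ (k * m))⁻¹ ≤ 2 ^ (k * m) := by
    rw [← inv_pow]
    apply pow_le_pow_left₀ (by rw [inv_nonneg]; linarith)
    rw [inv_le_comm₀ (by linarith) (by norm_num)]
    linarith
  have hnum : |(1 - ν * x) ^ m - (1 - x) ^ (k * m)| ≤
      C₁ * x ^ 2 + C₂ * x ^ 2 + m * ((k - ν) * x) := by
    have e : (1 - ν * x) ^ m - (1 - x) ^ (k * m) =
        ((1 - ν * x) ^ m - (1 - m * ν * x)) -
          ((1 - 1 * x) ^ (k * m) - (1 - (k * m : ℕ) * 1 * x)) + m * ((k - ν) * x) := by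
      push_cast; ring
    rw [e]
    refine (abs_add_le _ _).trans (add_le_add ((abs_sub _ _).trans ?_) ?_)
    · exact add_le_add (h₁ x hx (by linarith)) (h₂ x hx (by linarith))
    · rw [abs_of_nonneg (by positivity)]
  rw [hfac, abs_mul, abs_of_pos (inv_pos.2 hpos)]
  calc _ ≤ (C₁ * x ^ 2 + C₂ * x ^ 2 + m * ((k - ν) * x)) * 2 ^ (k * m) := by gcongr
    _ ≤ ((C₁ + C₂ + m) * (x ^ 2 + (k - ν) * x)) * 2 ^ (k * m) := by
      gcongr
      nlinarith [mul_nonneg hC₁ hkν, mul_nonneg hC₂ hkν,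
        mul_nonneg (Nat.cast_nonneg (α := ℝ) m) (sq_nonneg x)]
    _ = _ := by ring

/-- Ordered pairs of distinct indices. -/
abbrev OrdPair (k : ℕ) : Type := {x : Fin k × Fin k // x.1 ≠ x.2}

/-- `CoincidesAt u (some (i, j))` says `u i = u j`, and `CoincidesAt u none` always holds. -/
def CoincidesAt {k : ℕ} {α : Type*} (u : Fin k → α) : Option (OrdPair k) → Prop
  | none => True
  | some x => u x.1.1 = u x.1.2

/-- The size `p⁻²` of the generic local deviation at `p`, and `p⁻¹` of that of a coincidence. -/
noncomputable def deviationWeight {k : ℕ} (p : ℕ) : Option (OrdPair k) → ℝ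
  | none => 1 / (p : ℝ) ^ 2
  | some _ => 1 / (p : ℝ)

lemma deviationWeight_nonneg {k : ℕ} (p : ℕ) (o : Option (OrdPair k)) :
    0 ≤ deviationWeight p o := by
  cases o <;> simp [deviationWeight]

/-- The amount by which the `m`-th power of the local factor at `p` differs from `1`. -/
noncomputable def localDeviation {k : ℕ} (m p : ℕ) (u : Fin k → ZMod p) : ℝ :=
  ((1 - ((Set.range u).ncard : ℝ) / p) * (1 - 1 / (p : ℝ)) ^ (-(k : ℤ))) ^ m - 1

lemma ncard_range_le {k : ℕ} {α : Type*} (u : Fin k → α) : (Set.range u).ncard ≤ k := by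
  rw [← Set.image_univ]
  simpa [Set.ncard_univ] using Set.ncard_image_le (f := u) Set.finite_univ

open Classical in
lemma exists_abs_localDeviation_le (k m : ℕ) :
    ∃ C, 0 ≤ C ∧ ∀ p : ℕ, p.Prime → ∀ u : Fin k → ZMod p,
      |localDeviation m p u| ≤
        ∑ o : Option (OrdPair k), C * deviationWeight p o * (if CoincidesAt u o then 1 else 0) := by
  have key : ∀ ν : Fin (k + 1), ∃ C, 0 ≤ C ∧ ∀ x : ℝ, 0 ≤ x → x ≤ 1 / 2 →
      |((1 - (ν : ℕ) * x) * (1 - x) ^ (-(k : ℤ))) ^ m - 1| ≤ C * (x ^ 2 + (k - (ν : ℕ)) * x) :=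
    fun ν => exists_abs_local_factor_sub_one_le k m _ (by exact_mod_cast Nat.lt_succ_iff.1 ν.2)
  choose C hC h using key
  have hS : 0 ≤ ∑ ν, C ν := Finset.sum_nonneg fun ν _ => hC ν
  refine ⟨(∑ ν, C ν) * (k + 1), by positivity, fun p hp u => ?_⟩
  set x : ℝ := 1 / (p : ℝ) with hx
  have hx0 : 0 ≤ x := by positivity
  have hx2 : x ≤ 1 / 2 := by
    rw [hx]
    exact one_div_le_one_div_of_le (by norm_num) (by exact_mod_cast hp.two_le)
  let ν : Fin (k + 1) := ⟨(Set.range u).ncard, Nat.lt_succ_iff.2 (ncard_range_le u)⟩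
  have hdev : |localDeviation m p u| ≤
      (∑ ν, C ν) * (x ^ 2 + (k - ((Set.range u).ncard : ℝ)) * x) := by
    have hν : ((Set.range u).ncard : ℝ) ≤ k := by exact_mod_cast ncard_range_le u
    have := h ν x hx0 hx2
    rw [localDeviation, ← hx, div_eq_mul_one_div, ← hx]
    refine this.trans (mul_le_mul_of_nonneg_right
      (Finset.single_le_sum (fun i _ => hC i) (Finset.mem_univ ν)) ?_)
    have : 0 ≤ (k - ((Set.range u).ncard : ℝ)) * x := mul_nonneg (by linarith) hx0
    positivity
  refine hdev.trans ?_
  rw [Fintype.sum_option, mul_assoc (∑ ν, C ν)]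
  by_cases hu : Function.Injective u
  · rw [Set.ncard_range_of_injective hu]
    have : 0 ≤ ∑ y : OrdPair k, (∑ ν, C ν) * ((k : ℝ) + 1) * deviationWeight p (some y) *
        (if CoincidesAt u (some y) then 1 else 0) := by
      refine Finset.sum_nonneg fun y _ => ?_
      have := deviationWeight_nonneg p (some y)
      split_ifs <;> positivity
    have h2 : deviationWeight (k := k) p none = x ^ 2 := by rw [deviationWeight, hx]; ring
    rw [h2, if_pos (show CoincidesAt u none from trivial), Nat.card_fin, sub_self, zero_mul,
      add_zero, mul_one]
    have : (∑ ν, C ν) * x ^ 2 ≤ (∑ ν, C ν) * ((k + 1) * x ^ 2) := by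
      gcongr
      nlinarith [mul_nonneg (Nat.cast_nonneg (α := ℝ) k) (sq_nonneg x)]
    linarith
  · obtain ⟨i, j, hij, hne⟩ : ∃ i j, u i = u j ∧ i ≠ j := by
      simpa [Function.Injective] using hu
    have h1 : (∑ ν, C ν) * ((k : ℝ) + 1) * x ≤
        ∑ y : OrdPair k, (∑ ν, C ν) * ((k : ℝ) + 1) * deviationWeight p (some y) *
        (if CoincidesAt u (some y) then 1 else 0) := by
      have := Finset.single_le_sum (f := fun y : OrdPair k => (∑ ν, C ν) * ((k : ℝ) + 1) *
        deviationWeight p (some y) * (if CoincidesAt u (some y) then 1 else 0))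
        (fun y _ => ?_) (Finset.mem_univ (⟨(i, j), hne⟩ : OrdPair k))
      · simpa [CoincidesAt, hij, deviationWeight, hx] using this
      · have := deviationWeight_nonneg p (some y)
        split_ifs <;> positivity
    have h2 : (∑ ν, C ν) * x ^ 2 ≤ (∑ ν, C ν) * (((k : ℝ) + 1) *
        deviationWeight (k := k) p none) * (if CoincidesAt u none then 1 else 0) := by
      have h2 : deviationWeight (k := k) p none = x ^ 2 := by rw [deviationWeight, hx]; ring
      rw [h2, if_pos (show CoincidesAt u none from trivial), mul_one]
      gcongr
      nlinarith [mul_nonneg (Nat.cast_nonneg (α := ℝ) k) (sq_nonneg x)]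
    have h3 : (∑ ν, C ν) * ((k - ((Set.range u).ncard : ℝ)) * x) ≤
        (∑ ν, C ν) * ((k + 1) * x) := by
      gcongr
      have : (0 : ℝ) ≤ (Set.range u).ncard := by positivity
      linarith
    linarith

lemma card_filter_piFinset_Icc_le {k H n : ℕ} (R : ℕ → ℕ → Prop) [DecidableRel R]
    (hR : ∀ b ∈ Finset.Icc 1 H, ((Finset.Icc 1 H).filter fun a => R a b).card ≤ n) {i j : Fin k} (hij : i ≠ j) :
    ((Fintype.piFinset fun _ : Fin k => Finset.Icc 1 H).filter fun h => R (h i) (h j)).card ≤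
      n * H ^ (k - 1) := by
  have hcard : (Fintype.piFinset fun _ : {t : Fin k // t ≠ i} => Finset.Icc 1 H).card =
      H ^ (k - 1) := by
    simp [Fintype.card_subtype_compl]
  rw [← hcard]
  refine Finset.card_le_mul_card_image_of_maps_to (f := fun h t => h t.1) ?_ n fun b hb => ?_
  · intro h hh
    simp only [Finset.mem_filter, Fintype.mem_piFinset] at hh ⊢
    exact fun t => hh.1 t
  · refine (Finset.card_le_card_of_injOn (fun h => h i) ?_ ?_).trans (hR _ (Fintype.mem_piFinset.1 hb ⟨j, hij.symm⟩))
    · intro h hh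
      simp only [Finset.coe_filter, Finset.mem_filter, Fintype.mem_piFinset,
        Set.mem_ofPred_eq] at hh ⊢
      refine ⟨hh.1.1 i, ?_⟩
      rw [← hh.2]
      exact hh.1.2
    · intro h hh h' hh' e
      simp only [Finset.coe_filter, Finset.mem_filter, Set.mem_ofPred_eq] at hh hh'
      funext t
      by_cases ht : t = i
      · rw [ht]; exact e
      · exact congrFun (hh.2.trans hh'.2.symm) ⟨t, ht⟩

lemma card_filter_modEq_ne_le (H : ℕ) {e : ℕ} (he : 0 < e) {b : ℕ}
    (hb : b ∈ Finset.Icc 1 H) :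
    ((Finset.Icc 1 H).filter fun a => a ≠ b ∧ a ≡ b [MOD e]).card ≤ H / e := by
  rw [Nat.le_div_iff_mul_le he]
  have hIoc : Finset.Icc 1 H = Finset.Ioc 0 H := rfl
  have hset : ((Finset.Icc 1 H).filter fun a => a ≠ b ∧ a ≡ b [MOD e]) =
      ((Finset.Ioc 0 H).filter fun a => a ≡ b [MOD e]).erase b := by
    ext a
    rw [hIoc]
    simp only [Finset.mem_filter, Finset.mem_erase]
    tauto
  have hmem : b ∈ (Finset.Ioc 0 H).filter fun a => a ≡ b [MOD e] := by
    rw [Finset.mem_filter, ← hIoc]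
    exact ⟨hb, Nat.ModEq.refl b⟩
  have hcount := Nat.Ioc_filter_modEq_card 0 H he b
  have hpos := Finset.card_pos.2 ⟨b, hmem⟩
  rw [hset, Finset.card_erase_of_mem hmem]
  generalize ((Finset.Ioc 0 H).filter fun a => a ≡ b [MOD e]).card = c at *
  have hc : (c : ℤ) = ⌊((H : ℚ) - b) / e⌋ - ⌊(((0 : ℕ) : ℚ) - b) / e⌋ := by omega
  have h1 := Int.floor_le (((H : ℚ) - b) / e)
  have h2 := Int.lt_floor_add_one ((((0 : ℕ) : ℚ) - b) / e)
  have he' : (0 : ℚ) < e := by exact_mod_cast he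
  have hc' : (c : ℚ) = (⌊((H : ℚ) - b) / e⌋ : ℚ) - (⌊(((0 : ℕ) : ℚ) - b) / e⌋ : ℚ) := by
    exact_mod_cast hc
  rw [le_div_iff₀ he'] at h1
  rw [div_lt_iff₀ he'] at h2
  obtain ⟨c, rfl⟩ : ∃ c', c = c' + 1 := ⟨c - 1, by omega⟩
  have : (c : ℚ) * e ≤ H := by
    push_cast at hc' h2
    have : (c : ℚ) * e = (⌊((H : ℚ) - b) / e⌋ : ℚ) * e - (⌊((0 : ℚ) - b) / e⌋ : ℚ) * e - e := by
      linear_combination (e : ℚ) * hc'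
    linarith
  exact_mod_cast this

/-- The modulus imposed by a coincidence at `p`; no condition has modulus `1`. -/
def coincidenceModulus {k : ℕ} (p : ℕ) : Option (OrdPair k) → ℕ
  | none => 1
  | some _ => p

open Classical in
lemma card_coincidence_pow_mul_le {k : ℕ} (H : ℕ) {σ : Type*} [Fintype σ] (P : σ → ℕ)
    (hP : ∀ p, 0 < P p) (hcop : Pairwise (Function.onFun Nat.Coprime P))
    (φ : σ → Option (OrdPair k)) :
    ((distinctTuples k H).filter fun h =>
        ∀ p, CoincidesAt (fun i => (h i : ZMod (P p))) (φ p)).card ^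
          Fintype.card (Option (OrdPair k)) * ∏ p, coincidenceModulus (P p) (φ p) ≤
      (H ^ k) ^ Fintype.card (Option (OrdPair k)) := by
  set N := ((distinctTuples k H).filter fun h =>
        ∀ p, CoincidesAt (fun i => (h i : ZMod (P p))) (φ p)).card
  rw [← Finset.prod_fiberwise Finset.univ φ, ← Finset.card_univ, ← Finset.prod_const,
    ← Finset.prod_const, ← Finset.prod_mul_distrib]
  refine Finset.prod_le_prod' fun o _ => ?_
  have hfilter : (∏ p ∈ Finset.univ.filter (fun p => φ p = o), coincidenceModulus (P p) (φ p)) =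
      ∏ p ∈ Finset.univ.filter (fun p => φ p = o), coincidenceModulus (P p) o :=
    Finset.prod_congr rfl fun p hp => by rw [(Finset.mem_filter.1 hp).2]
  rw [hfilter]
  cases o with
  | none =>
    simp only [coincidenceModulus, Finset.prod_const_one, mul_one]
    refine (Finset.card_filter_le _ _).trans ((Finset.card_filter_le _ _).trans ?_)
    simp
  | some x =>
    simp only [coincidenceModulus]
    set e := ∏ p ∈ Finset.univ.filter (fun p => φ p = some x), P p
    have he : 0 < e := Finset.prod_pos fun p _ => hP p
    have hk : H ^ k = H * H ^ (k - 1) := by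
      rw [← pow_succ', Nat.sub_add_cancel (Fin.pos x.1.1)]
    have hN : N ≤ H / e * H ^ (k - 1) := by
      refine (Finset.card_le_card ?_).trans (card_filter_piFinset_Icc_le
        (fun a b => a ≠ b ∧ a ≡ b [MOD e]) (fun b hb => ?_) x.2)
      · intro h hh
        simp only [Finset.mem_filter, distinctTuples] at hh ⊢
        refine ⟨hh.1.1, fun e => x.2 (hh.1.2 e), ?_⟩
        rw [Nat.modEq_iff_dvd, Nat.cast_prod]
        refine Finset.prod_dvd_of_coprime (fun p _ q _ hpq => ?_) fun p hp => ?_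
        · exact Nat.isCoprime_iff_coprime.2 (hcop hpq)
        · have := hh.2 p
          rw [(Finset.mem_filter.1 hp).2, CoincidesAt, ZMod.natCast_eq_natCast_iff,
            Nat.modEq_iff_dvd] at this
          exact this
      · convert card_filter_modEq_ne_le H he hb
    calc N * e ≤ H / e * H ^ (k - 1) * e := Nat.mul_le_mul_right _ hN
      _ = H / e * e * H ^ (k - 1) := by ring
      _ ≤ H * H ^ (k - 1) := Nat.mul_le_mul_right _ (Nat.div_mul_le_self _ _)
      _ = H ^ k := hk.symm

lemma le_mul_rpow_of_pow_mul_le {L : ℕ} (hL : L ≠ 0) {N W M : ℝ} (hM : 0 ≤ M)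
    (hW : 0 < W) (h : N ^ L * W ≤ M ^ L) : N ≤ M * W ^ (-(1 / L : ℝ)) := by
  refine le_of_pow_le_pow_left₀ hL (by positivity) ?_
  rw [mul_pow, ← Real.rpow_natCast (W ^ _), ← Real.rpow_mul hW.le]
  have hL' : (L : ℝ) ≠ 0 := by exact_mod_cast hL
  rw [show -(1 / (L : ℝ)) * L = -1 by field_simp, Real.rpow_neg_one, ← div_eq_mul_inv,
    le_div_iff₀ hW]
  exact h

/-- A summable majorant for the average size of the deviations at `p`. -/
noncomputable def deviationBound (k : ℕ) (C : ℝ) (p : ℕ) : ℝ :=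
  ∑ o : Option (OrdPair k), C * deviationWeight p o *
    (coincidenceModulus p o : ℝ) ^ (-(1 / Fintype.card (Option (OrdPair k)) : ℝ))

lemma deviationBound_nonneg (k : ℕ) {C : ℝ} (hC : 0 ≤ C) (p : ℕ) : 0 ≤ deviationBound k C p :=
  Finset.sum_nonneg fun o _ => by
    have := deviationWeight_nonneg p o
    positivity

lemma summable_deviationBound (k : ℕ) (C : ℝ) :
    Summable fun p : Nat.Primes => deviationBound k C p := by
  refine summable_sum fun o _ => ?_
  simp only [mul_assoc]
  refine Summable.mul_left _ ?_
  cases o with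
  | none =>
    refine (Nat.Primes.summable_rpow (r := -2).2 (by norm_num)).congr fun p => ?_
    simp only [deviationWeight, coincidenceModulus, Nat.cast_one, Real.one_rpow, mul_one]
    rw [Real.rpow_neg (Nat.cast_nonneg _), one_div]
    norm_cast
  | some x =>
    have hL : (0 : ℝ) < 1 / Fintype.card (Option (OrdPair k)) := by
      have : 0 < Fintype.card (Option (OrdPair k)) := Fintype.card_pos
      positivity
    refine (Nat.Primes.summable_rpow
      (r := -1 + -(1 / Fintype.card (Option (OrdPair k)) : ℝ)).2 (by linarith)).congr fun p => ?_
    simp only [deviationWeight, coincidenceModulus]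
    rw [Real.rpow_add (by exact_mod_cast p.2.pos), Real.rpow_neg_one, one_div (p : ℝ)]

open Classical in
lemma sum_abs_prod_le_of_coincidence_bound {k : ℕ} (H : ℕ) {σ : Type*} [Fintype σ] (P : σ → ℕ)
    (hP : ∀ p, 0 < P p) (hcop : Pairwise (Function.onFun Nat.Coprime P)) {C : ℝ} (hC : 0 ≤ C)
    (F : ∀ p, (Fin k → ZMod (P p)) → ℝ)
    (hF : ∀ p u, |F p u| ≤ ∑ o : Option (OrdPair k),
      C * deviationWeight (P p) o * (if CoincidesAt u o then 1 else 0)) :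
    ∑ h ∈ distinctTuples k H, |∏ p, F p (fun i => (h i : ZMod (P p)))| ≤
      (H : ℝ) ^ k * ∏ p, deviationBound k C (P p) := by
  set L := Fintype.card (Option (OrdPair k)) with hL
  calc ∑ h ∈ distinctTuples k H, |∏ p, F p (fun i => (h i : ZMod (P p)))|
      ≤ ∑ h ∈ distinctTuples k H, ∏ p, ∑ o : Option (OrdPair k),
          C * deviationWeight (P p) o *
            (if CoincidesAt (fun i => (h i : ZMod (P p))) o then 1 else 0) := by
        refine Finset.sum_le_sum fun h _ => ?_
        rw [Finset.abs_prod]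
        exact Finset.prod_le_prod (fun p _ => abs_nonneg _) fun p _ => hF p _
    _ = ∑ φ : σ → Option (OrdPair k), (∏ p, C * deviationWeight (P p) (φ p)) *
          ((distinctTuples k H).filter fun h =>
            ∀ p, CoincidesAt (fun i => (h i : ZMod (P p))) (φ p)).card := by
        simp_rw [Finset.prod_univ_sum, Fintype.piFinset_univ]
        rw [Finset.sum_comm]
        refine Finset.sum_congr rfl fun φ _ => ?_
        simp_rw [Finset.prod_mul_distrib, ← Finset.mul_sum, Finset.prod_boole]
        simp
    _ ≤ ∑ φ : σ → Option (OrdPair k), (∏ p, C * deviationWeight (P p) (φ p)) *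
          ((H : ℝ) ^ k * ∏ p, (coincidenceModulus (P p) (φ p) : ℝ) ^ (-(1 / L : ℝ))) := by
        refine Finset.sum_le_sum fun φ _ => mul_le_mul_of_nonneg_left ?_
          (Finset.prod_nonneg fun p _ => mul_nonneg hC (deviationWeight_nonneg _ _))
        rw [Real.finsetProd_rpow _ _ fun p _ => Nat.cast_nonneg _]
        refine le_mul_rpow_of_pow_mul_le Fintype.card_ne_zero (by positivity) ?_ ?_
        · refine Finset.prod_pos fun p _ => ?_
          have := hP p
          cases φ p <;> simp [coincidenceModulus, this]
        · exact_mod_cast card_coincidence_pow_mul_le H P hP hcop φ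
    _ = (H : ℝ) ^ k * ∏ p, deviationBound k C (P p) := by
        simp_rw [deviationBound, Finset.prod_univ_sum, Fintype.piFinset_univ, Finset.mul_sum]
        refine Finset.sum_congr rfl fun φ _ => ?_
        rw [Finset.prod_mul_distrib (f := fun p => C * deviationWeight (P p) (φ p))]
        ring

lemma Nat.Primes.pairwise_coprime_coe (s : Finset Nat.Primes) :
    Pairwise (Function.onFun Nat.Coprime fun p : s => ((p : Nat.Primes) : ℕ)) := fun p q hpq =>
  (Nat.coprime_primes p.1.2 q.1.2).2 fun e => hpq (Subtype.ext (Subtype.ext e))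

lemma abs_card_filter_modEq_mul_sub_le (H : ℕ) {e : ℕ} (he : 0 < e) (v : ℕ) :
    |(((Finset.Icc 1 H).filter fun a => a ≡ v [MOD e]).card : ℝ) * e - H| ≤ e := by
  have hcount := Nat.Ioc_filter_modEq_card 0 H he v
  have he' : (0 : ℚ) < e := by exact_mod_cast he
  rw [show Finset.Ioc 0 H = Finset.Icc 1 H from rfl, max_eq_left] at hcount
  · generalize ((Finset.Icc 1 H).filter fun a => a ≡ v [MOD e]).card = c at *
    have h1 := Int.floor_le (((H : ℚ) - v) / e)
    have h2 := Int.lt_floor_add_one ((((0 : ℕ) : ℚ) - v) / e)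
    have h3 := Int.floor_le ((((0 : ℕ) : ℚ) - v) / e)
    have h4 := Int.lt_floor_add_one (((H : ℚ) - v) / e)
    rw [le_div_iff₀ he'] at h1 h3
    rw [div_lt_iff₀ he'] at h2 h4
    have hc' : (c : ℚ) = (⌊((H : ℚ) - v) / e⌋ : ℚ) - (⌊(((0 : ℕ) : ℚ) - v) / e⌋ : ℚ) := by
      exact_mod_cast hcount
    have : |(c : ℚ) * e - H| ≤ e := by
      rw [hc', abs_le]
      push_cast at *
      constructor <;> linarith
    exact_mod_cast this
  · rw [sub_nonneg]
    apply Int.floor_le_floor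
    gcongr
    simp

lemma tendsto_card_filter_modEq_div {e : ℕ} (he : 0 < e) (v : ℕ) :
    Tendsto (fun H : ℕ => (((Finset.Icc 1 H).filter fun a => a ≡ v [MOD e]).card : ℝ) / H)
      atTop (𝓝 (1 / e)) := by
  rw [tendsto_iff_norm_sub_tendsto_zero]
  refine squeeze_zero' (Eventually.of_forall fun _ => norm_nonneg _) ?_
    (tendsto_one_div_atTop_nhds_zero_nat (𝕜 := ℝ))
  filter_upwards [eventually_gt_atTop 0] with H hH
  have h := abs_card_filter_modEq_mul_sub_le H he v
  have he' : (0 : ℝ) < e := by exact_mod_cast he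
  have hH' : (0 : ℝ) < H := by exact_mod_cast hH
  rw [Real.norm_eq_abs, div_sub_div _ _ hH'.ne' he'.ne', abs_div, abs_of_pos (mul_pos hH' he'),
    div_le_div_iff₀ (mul_pos hH' he') hH', mul_one]
  nlinarith

open Classical in
lemma tendsto_card_filter_residues_div {σ : Type*} [Fintype σ] (P : σ → ℕ) [∀ p, NeZero (P p)]
    (hcop : Pairwise (Function.onFun Nat.Coprime P)) (w : ∀ p, ZMod (P p)) :
    Tendsto (fun H : ℕ =>
        (((Finset.Icc 1 H).filter fun a : ℕ => ∀ p, (a : ZMod (P p)) = w p).card : ℝ) / H)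
      atTop (𝓝 (∏ p, (1 / (P p : ℝ)))) := by
  have hQ : 0 < ∏ p, P p := Finset.prod_pos fun p _ => Nat.pos_of_ne_zero (NeZero.ne _)
  have : NeZero (∏ p, P p) := ⟨hQ.ne'⟩
  set v := (ZMod.prodEquivPi P hcop).symm w with hv
  have hiff : ∀ a : ℕ, (∀ p, (a : ZMod (P p)) = w p) ↔ a ≡ v.val [MOD ∏ p, P p] := by
    intro a
    rw [← ZMod.natCast_eq_natCast_iff, ZMod.natCast_zmod_val, hv, RingEquiv.eq_symm_apply,
      map_natCast, funext_iff]
    rfl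
  have := tendsto_card_filter_modEq_div hQ v.val
  simp_rw [← hiff] at this
  convert this using 2
  push_cast
  simp

open Classical in
lemma tendsto_sum_box_prod_div {k : ℕ} {σ : Type*} [Fintype σ] (P : σ → ℕ) [∀ p, NeZero (P p)]
    (hcop : Pairwise (Function.onFun Nat.Coprime P)) (F : ∀ p, (Fin k → ZMod (P p)) → ℝ) :
    Tendsto (fun H : ℕ => (∑ h ∈ Fintype.piFinset fun _ : Fin k => Finset.Icc 1 H,
        ∏ p, F p (fun i => (h i : ZMod (P p)))) / (H : ℝ) ^ k)
      atTop (𝓝 (∏ p, ((P p : ℝ) ^ (-(k : ℤ)) * ∑ u, F p u))) := by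
  have hsum : ∀ H : ℕ, (∑ h ∈ Fintype.piFinset fun _ : Fin k => Finset.Icc 1 H,
        ∏ p, F p (fun i => (h i : ZMod (P p)))) / (H : ℝ) ^ k =
      ∑ w : ∀ p, Fin k → ZMod (P p), (∏ p, F p (w p)) * ∏ i,
        ((((Finset.Icc 1 H).filter fun a : ℕ => ∀ p, (a : ZMod (P p)) = w p i).card : ℝ) / H) := by
    intro H
    rw [← Finset.sum_fiberwise _ (fun h : Fin k → ℕ => fun p i => (h i : ZMod (P p))),
      Finset.sum_div]
    refine Finset.sum_congr rfl fun w _ => ?_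
    have hfilter : ((Fintype.piFinset fun _ : Fin k => Finset.Icc 1 H).filter fun h =>
        (fun p i => (h i : ZMod (P p))) = w) = Fintype.piFinset fun i =>
          (Finset.Icc 1 H).filter fun a : ℕ => ∀ p, (a : ZMod (P p)) = w p i := by
      ext h
      simp only [Finset.mem_filter, Fintype.mem_piFinset, funext_iff]
      exact ⟨fun a i => ⟨a.1 i, fun p => a.2 p i⟩, fun a => ⟨fun i => (a i).1, fun p i => (a i).2 p⟩⟩
    rw [Finset.sum_congr rfl fun h hh => by
      rw [show ∏ p, F p (fun i => (h i : ZMod (P p))) = ∏ p, F p (w p) by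
        rw [← (Finset.mem_filter.1 hh).2]], Finset.sum_const, hfilter, Fintype.card_piFinset,
      Finset.prod_div_distrib]
    simp only [nsmul_eq_mul, Nat.cast_prod, Finset.prod_const, Finset.card_univ, Fintype.card_fin]
    ring
  simp_rw [hsum]
  have hlim : ∏ p, ((P p : ℝ) ^ (-(k : ℤ)) * ∑ u, F p u) =
      ∑ w : ∀ p, Fin k → ZMod (P p), (∏ p, F p (w p)) * ∏ _i : Fin k, ∏ p, (1 / (P p : ℝ)) := by
    rw [← Finset.sum_mul, Finset.prod_mul_distrib, Finset.prod_univ_sum, Fintype.piFinset_univ,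
      mul_comm]
    congr 1
    simp [Finset.prod_inv_distrib, Finset.prod_pow]
  rw [hlim]
  exact tendsto_finsetSum _ fun w _ => (tendsto_finsetProd _ fun i _ =>
    tendsto_card_filter_residues_div P hcop fun p => w p i).const_mul _

open Classical in
lemma card_box_sdiff_distinctTuples_le (k H : ℕ) :
    ((Fintype.piFinset fun _ : Fin k => Finset.Icc 1 H) \ distinctTuples k H).card ≤
      Fintype.card (OrdPair k) * H ^ (k - 1) := by
  have hsub : ((Fintype.piFinset fun _ : Fin k => Finset.Icc 1 H) \ distinctTuples k H) ⊆
      Finset.univ.biUnion fun x : OrdPair k =>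
        (Fintype.piFinset fun _ : Fin k => Finset.Icc 1 H).filter fun h => h x.1.1 = h x.1.2 := by
    intro h hh
    rw [Finset.mem_sdiff, distinctTuples, Finset.mem_filter, not_and] at hh
    obtain ⟨i, j, hij, hne⟩ : ∃ i j, h i = h j ∧ i ≠ j := by
      simpa [Function.Injective] using hh.2 hh.1
    exact Finset.mem_biUnion.2 ⟨⟨(i, j), hne⟩, Finset.mem_univ _,
      Finset.mem_filter.2 ⟨hh.1, hij⟩⟩
  refine (Finset.card_le_card hsub).trans (Finset.card_biUnion_le_card_mul _ _ _ fun x _ => ?_)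
  have h := card_filter_piFinset_Icc_le (H := H) (n := 1) (fun a b => a = b)
    (fun b _ => by
      rw [Finset.card_le_one]
      intro a ha a' ha'
      rw [Finset.mem_filter] at ha ha'
      exact ha.2.trans ha'.2.symm) x.2
  rw [one_mul] at h
  convert h

lemma tendsto_sum_distinctTuples_div {k : ℕ} (hk : 1 ≤ k) {f : (Fin k → ℕ) → ℝ} {M l : ℝ}
    (hM : ∀ h, |f h| ≤ M)
    (hf : Tendsto (fun H : ℕ => (∑ h ∈ Fintype.piFinset fun _ : Fin k => Finset.Icc 1 H, f h) /
      (H : ℝ) ^ k) atTop (𝓝 l)) :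
    Tendsto (fun H : ℕ => (∑ h ∈ distinctTuples k H, f h) / (H : ℝ) ^ k) atTop (𝓝 l) := by
  classical
  have herr : Tendsto (fun H : ℕ => (∑ h ∈ (Fintype.piFinset fun _ : Fin k => Finset.Icc 1 H) \
      distinctTuples k H, f h) / (H : ℝ) ^ k) atTop (𝓝 0) := by
    have hlim := (tendsto_one_div_atTop_nhds_zero_nat (𝕜 := ℝ)).const_mul
      (Fintype.card (OrdPair k) * M)
    rw [mul_zero] at hlim
    refine squeeze_zero_norm' ?_ hlim
    filter_upwards [eventually_gt_atTop 0] with H hH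
    have hH' : (0 : ℝ) < H := by exact_mod_cast hH
    have hM0 : 0 ≤ M := (abs_nonneg _).trans (hM fun _ => 0)
    rw [norm_div, Real.norm_of_nonneg (by positivity : (0 : ℝ) ≤ (H : ℝ) ^ k),
      div_le_iff₀ (by positivity)]
    have hpow : (H : ℝ) ^ k = H * (H : ℝ) ^ (k - 1) := by
      rw [← pow_succ', Nat.sub_add_cancel hk]
    calc _ ≤ (((Fintype.piFinset fun _ : Fin k => Finset.Icc 1 H) \
            distinctTuples k H).card : ℝ) * M := by
          rw [← nsmul_eq_mul]
          exact (norm_sum_le _ _).trans (Finset.sum_le_card_nsmul _ _ _ fun h _ => hM h)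
      _ ≤ (Fintype.card (OrdPair k) * (H : ℝ) ^ (k - 1)) * M := by
          gcongr
          exact_mod_cast card_box_sdiff_distinctTuples_le k H
      _ = _ := by
          rw [hpow]
          field_simp
  have := hf.sub herr
  rw [sub_zero] at this
  refine this.congr fun H => ?_
  have hsub : distinctTuples k H ⊆ Fintype.piFinset fun _ : Fin k => Finset.Icc 1 H :=
    Finset.filter_subset _ _
  rw [← sub_div, ← Finset.sum_sdiff hsub, add_sub_cancel_left]

lemma singFactor_pow_eq {k : ℕ} (h : Fin k → ℕ) (m p : ℕ) :
    singFactor h p ^ m = 1 + localDeviation m p (fun i => (h i : ZMod p)) := by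
  rw [localDeviation, add_sub_cancel, singFactor, nup]

lemma average_localDeviation_eq (k m : ℕ) (p : Nat.Primes) [Fintype (ZMod p)] :
    ((p : ℕ) : ℝ) ^ (-(k : ℤ)) * ∑ u : Fin k → ZMod p, localDeviation m p u =
      muFactor k m p - 1 := by
  have hp : ((p : ℕ) : ℝ) ≠ 0 := by exact_mod_cast p.2.ne_zero
  have hcard : Fintype.card (ZMod p) = p := by
    have : NeZero (p : ℕ) := ⟨p.2.ne_zero⟩
    rw [← Nat.card_eq_fintype_card, Nat.card_zmod]
  simp only [localDeviation]
  rw [Finset.sum_sub_distrib, mul_sub]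
  congr 1
  · rw [muFactor, halfTerm, mul_left_comm]
    congr 1
    simp_rw [mul_pow]
    rw [← Finset.sum_mul, mul_comm]
    congr 1
    · rw [← zpow_natCast, ← zpow_mul]
      congr 1
      push_cast
      ring
    · congr!
  · simp [hcard, hp]

lemma summable_localDeviation {k m : ℕ} {h : Fin k → ℕ} (hh : Function.Injective h) :
    Summable fun p : Nat.Primes => ‖localDeviation m p (fun i => (h i : ZMod p))‖ := by
  classical
  obtain ⟨C, hC, hb⟩ := exists_abs_localDeviation_le k m
  refine Summable.of_nonneg_of_le (fun p => norm_nonneg _) (fun p => hb p p.2 _) ?_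
  refine summable_sum fun o _ => ?_
  cases o with
  | none =>
    refine Summable.of_nonneg_of_le (fun p => ?_) (fun p => ?_)
      ((Nat.Primes.summable_rpow (r := -2).2 (by norm_num)).mul_left C)
    · have := deviationWeight_nonneg (k := k) p none
      split_ifs <;> positivity
    · rw [if_pos (show CoincidesAt _ none from trivial), mul_one, deviationWeight,
        Real.rpow_neg (Nat.cast_nonneg _), one_div]
      norm_cast
  | some x =>
    have hd : (h x.1.2 : ℤ) - h x.1.1 ≠ 0 := by
      have : h x.1.2 ≠ h x.1.1 := fun e => x.2 (hh e).symm
      omega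
    have hfin : {p : Nat.Primes | ((p : ℕ) : ℤ) ∣ (h x.1.2 : ℤ) - h x.1.1}.Finite := by
      refine Set.Finite.of_injOn (f := fun p : Nat.Primes => (p : ℕ))
        (t := {n | n ≤ ((h x.1.2 : ℤ) - h x.1.1).natAbs}) (fun p hp => ?_)
        (Subtype.val_injective.injOn) (Set.finite_le_nat _)
      exact Nat.le_of_dvd (Int.natAbs_pos.2 hd) (Int.natCast_dvd.1 hp)
    refine summable_of_hasFiniteSupport (hfin.subset fun p hp => ?_)
    by_contra hne
    refine hp ?_
    dsimp only
    rw [if_neg, mul_zero]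
    rw [CoincidesAt, ZMod.natCast_eq_natCast_iff, Nat.modEq_iff_dvd]
    exact hne

lemma singSeries_pow_eq_tsum {k : ℕ} (m : ℕ) {h : Fin k → ℕ} (hh : Function.Injective h) :
    singSeries h ^ m = ∑' s : Finset Nat.Primes,
      ∏ p ∈ s, localDeviation m p (fun i => (h i : ZMod p)) := by
  have hmul : Multipliable fun p : Nat.Primes => singFactor h p := by
    refine (multipliable_one_add_of_summable_prod
      (summable_finsetProd_of_summable_norm (summable_localDeviation (m := 1) hh))).congr
        fun p => ?_
    rw [← singFactor_pow_eq, pow_one]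
  rw [singSeries, ← hmul.tprod_pow, ← tprod_one_add
    (summable_finsetProd_of_summable_norm (summable_localDeviation hh))]
  exact tprod_congr fun p => singFactor_pow_eq h m p

lemma exists_sum_abs_prod_localDeviation_le (k m : ℕ) :
    ∃ C, 0 ≤ C ∧ ∀ (H : ℕ) (s : Finset Nat.Primes),
      ∑ h ∈ distinctTuples k H, |∏ p ∈ s, localDeviation m p (fun i => (h i : ZMod p))| ≤
        (H : ℝ) ^ k * ∏ p ∈ s, deviationBound k C p := by
  obtain ⟨C, hC, hb⟩ := exists_abs_localDeviation_le k m
  refine ⟨C, hC, fun H s => ?_⟩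
  simp_rw [← Finset.prod_coe_sort s]
  exact sum_abs_prod_le_of_coincidence_bound H (fun p : s => (p : ℕ)) (fun p => p.1.2.pos)
    (Nat.Primes.pairwise_coprime_coe s) hC (fun p => localDeviation m p) fun p u => hb p p.1.2 u

lemma tendsto_average_prod_localDeviation {k : ℕ} (hk : 1 ≤ k) (m : ℕ) (s : Finset Nat.Primes) :
    Tendsto (fun H : ℕ => (∑ h ∈ distinctTuples k H,
        ∏ p ∈ s, localDeviation m p (fun i => (h i : ZMod p))) / (H : ℝ) ^ k)
      atTop (𝓝 (∏ p ∈ s, (muFactor k m p - 1))) := by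
  obtain ⟨C, hC, hb⟩ := exists_abs_localDeviation_le k m
  have (p : s) : NeZero ((p : Nat.Primes) : ℕ) := ⟨p.1.2.ne_zero⟩
  have hbox := tendsto_sum_box_prod_div (fun p : s => ((p : Nat.Primes) : ℕ))
    (Nat.Primes.pairwise_coprime_coe s) (fun p => localDeviation (k := k) m p)
  simp_rw [average_localDeviation_eq] at hbox
  simp_rw [← Finset.prod_coe_sort s]
  refine tendsto_sum_distinctTuples_div hk
    (M := ∏ p : s, ∑ u : Fin k → ZMod p, |localDeviation m p u|) (fun h => ?_) hbox
  rw [Finset.abs_prod]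
  exact Finset.prod_le_prod (fun _ _ => abs_nonneg _) fun p _ =>
    Finset.single_le_sum (f := fun u => |localDeviation m p u|) (fun u _ => abs_nonneg _)
      (Finset.mem_univ (fun i => (h i : ZMod p)))

lemma abs_average_prod_localDeviation_le {k m : ℕ} {C : ℝ} (hC : 0 ≤ C)
    (hb : ∀ (H : ℕ) (s : Finset Nat.Primes),
      ∑ h ∈ distinctTuples k H, |∏ p ∈ s, localDeviation m p (fun i => (h i : ZMod p))| ≤
        (H : ℝ) ^ k * ∏ p ∈ s, deviationBound k C p) (H : ℕ) (s : Finset Nat.Primes) :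
    |(∑ h ∈ distinctTuples k H, ∏ p ∈ s, localDeviation m p (fun i => (h i : ZMod p))) /
      (H : ℝ) ^ k| ≤ ∏ p ∈ s, deviationBound k C p := by
  rw [abs_div, abs_of_nonneg (by positivity : (0 : ℝ) ≤ (H : ℝ) ^ k)]
  refine div_le_of_le_mul₀ (by positivity)
    (Finset.prod_nonneg fun p _ => deviationBound_nonneg k hC p) ?_
  rw [mul_comm]
  exact (Finset.abs_sum_le_sum_abs _ _).trans (hb H s)

/-- For integers `k, m ≥ 1`, the Euler product defining `μ_k(m)` converges absolutely,
and the `m`-th moment of the singular series over `k`-tuples equals `μ_k(m)`. -/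
theorem moments_eq_euler_product (k m : ℕ) (hk : 1 ≤ k) (hm : 1 ≤ m) :
    Summable (fun p : Nat.Primes => |muFactor k m p - 1|) ∧
    Multipliable (fun p : Nat.Primes => muFactor k m p) ∧
    Tendsto (fun H : ℕ => (∑ h ∈ distinctTuples k H, singSeries h ^ m) / (H : ℝ) ^ k)
      atTop (𝓝 (muMoment k m)) := by
  obtain ⟨C, hC, hb⟩ := exists_sum_abs_prod_localDeviation_le k m
  have hbound := abs_average_prod_localDeviation_le hC hb
  have hsum : Summable fun p : Nat.Primes => ‖muFactor k m p - 1‖ := by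
    refine Summable.of_nonneg_of_le (fun p => norm_nonneg _) (fun p => ?_)
      (summable_deviationBound k C)
    have := le_of_tendsto (tendsto_average_prod_localDeviation hk m {p}).abs
      (Eventually.of_forall fun H => hbound H {p})
    simpa using this
  have hexp : Summable fun s : Finset Nat.Primes => ∏ p ∈ s, (muFactor k m p - 1) :=
    summable_finsetProd_of_summable_norm hsum
  refine ⟨hsum, ?_, ?_⟩
  · simpa using multipliable_one_add_of_summable_prod hexp
  · have hmu : muMoment k m = ∑' s : Finset Nat.Primes, ∏ p ∈ s, (muFactor k m p - 1) := by
      rw [← tprod_one_add hexp, muMoment]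
      simp
    rw [hmu]
    have hswap : ∀ H : ℕ, (∑ h ∈ distinctTuples k H, singSeries h ^ m) / (H : ℝ) ^ k =
        ∑' s : Finset Nat.Primes, (∑ h ∈ distinctTuples k H,
          ∏ p ∈ s, localDeviation m p (fun i => (h i : ZMod p))) / (H : ℝ) ^ k := by
      intro H
      have hinj : ∀ h ∈ distinctTuples k H, Function.Injective h := fun h hh =>
        (Finset.mem_filter.1 hh).2
      rw [tsum_div_const, Summable.tsum_finsetSum fun h hh =>
        summable_finsetProd_of_summable_norm (summable_localDeviation (hinj h hh))]
      congr 1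
      exact Finset.sum_congr rfl fun h hh => singSeries_pow_eq_tsum m (hinj h hh)
    simp_rw [hswap]
    exact tendsto_tsum_of_dominated_convergence
      (summable_finsetProd_of_summable_nonneg (fun p => deviationBound_nonneg k hC p)
        (summable_deviationBound k C))
      (tendsto_average_prod_localDeviation hk m) (Eventually.of_forall hbound)
end

section
/- Let F be a nonempty finite set and let k, m ≥ 1 be integers. Then |F|^{−m} · Σ_{x ∈ F^m} (1 − ρ(x)/|F|)^k = |F|^{−k} · Σ_{u ∈ F^k} (1 − ρ(u)/|F|)^m, where ρ(·) denotes the number of distinct components of a tuple of elements of F. Both sides equal |F|^{−(m+k)} times the number of pairs (x,u) ∈ F^m × F^k such that no component of x equals a component of u. -/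
open Filter Topology

/-- The number of tuples `u` indexed by `κ` that share no component with `x`. -/
theorem ncard_tuples_avoiding {F ι κ : Type*} [Finite F] [Finite κ] (x : ι → F) :
    {u : κ → F | ∀ i j, x i ≠ u j}.ncard = ((Set.range x)ᶜ.ncard) ^ Nat.card κ := by
  have h : {u : κ → F | ∀ i j, x i ≠ u j} = {u | ∀ j, u j ∈ (Set.range x)ᶜ} := by
    ext u
    simp only [Set.mem_ofPred_eq, Set.mem_compl_iff, Set.mem_range, not_exists]
    exact forall_comm
  rw [h, ← Nat.card_coe_set_eq, ← Nat.card_coe_set_eq, ← Nat.card_fun]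
  exact Nat.card_congr (Equiv.subtypePiEquivPi (p := fun _ a => a ∈ (Set.range x)ᶜ))

/-- Pairs of tuples with no common component, counted by their first entry. -/
theorem ncard_disjoint_tuple_pairs {F ι κ : Type*} [Finite F] [Finite κ] [Fintype (ι → F)] :
    {xu : (ι → F) × (κ → F) | ∀ i j, xu.1 i ≠ xu.2 j}.ncard =
      ∑ x : ι → F, ((Set.range x)ᶜ.ncard) ^ Nat.card κ := by
  simp_rw [← ncard_tuples_avoiding, ← Nat.card_coe_set_eq, ← Nat.card_sigma]
  exact Nat.card_congr
    (Equiv.subtypeProdEquivSigmaSubtype fun (x : ι → F) (u : κ → F) => ∀ i j, x i ≠ u j)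

/-- The average over `x`, written as a normalized count of pairs with no common component. -/
theorem average_eq_ncard_disjoint_tuple_pairs (F : Type*) [Fintype F] [DecidableEq F]
    [Nonempty F] (k m : ℕ) :
    (1 / (Fintype.card F : ℝ) ^ m) *
        ∑ x : Fin m → F, (1 - ((Set.range x).ncard : ℝ) / (Fintype.card F : ℝ)) ^ k =
      (1 / (Fintype.card F : ℝ) ^ (m + k)) *
        ({xu : (Fin m → F) × (Fin k → F) | ∀ i j, xu.1 i ≠ xu.2 j}.ncard : ℝ) := by
  have hF : (Fintype.card F : ℝ) ≠ 0 := Nat.cast_ne_zero.2 Fintype.card_ne_zero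
  have hx (x : Fin m → F) : 1 - ((Set.range x).ncard : ℝ) / (Fintype.card F : ℝ) =
      ((Set.range x)ᶜ.ncard : ℝ) / (Fintype.card F : ℝ) := by
    have h : ((Set.range x).ncard : ℝ) + ((Set.range x)ᶜ.ncard : ℝ) = Fintype.card F := by
      rw [← Nat.card_eq_fintype_card]
      exact_mod_cast Set.ncard_add_ncard_compl (Set.range x)
    rw [one_sub_div hF, ← h, add_sub_cancel_left]
  simp_rw [ncard_disjoint_tuple_pairs, hx, div_pow, ← Finset.sum_div, Nat.card_fin]
  push_cast
  rw [pow_add]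
  field_simp

/-- For a nonempty finite set `F` and integers `k, m ≥ 1`, the symmetric identity
between the averages of `(1 - ρ(x)/|F|)^k` over `x ∈ F^m` and `(1 - ρ(u)/|F|)^m` over
`u ∈ F^k`; both equal `|F|^{-(m+k)}` times the number of pairs `(x, u)` with no common
component. Here `ρ(v)` is the number of distinct components of the tuple `v`. -/
theorem symmetry_local (F : Type*) [Fintype F] [DecidableEq F] (hF : Nonempty F)
    (k m : ℕ) (hk : 1 ≤ k) (hm : 1 ≤ m) :
    (1 / (Fintype.card F : ℝ) ^ m) *
        ∑ x : Fin m → F, (1 - ((Set.range x).ncard : ℝ) / (Fintype.card F : ℝ)) ^ k =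
      (1 / (Fintype.card F : ℝ) ^ k) *
        ∑ u : Fin k → F, (1 - ((Set.range u).ncard : ℝ) / (Fintype.card F : ℝ)) ^ m ∧
    (1 / (Fintype.card F : ℝ) ^ m) *
        ∑ x : Fin m → F, (1 - ((Set.range x).ncard : ℝ) / (Fintype.card F : ℝ)) ^ k =
      (1 / (Fintype.card F : ℝ) ^ (m + k)) *
        ({xu : (Fin m → F) × (Fin k → F) | ∀ i j, xu.1 i ≠ xu.2 j}.ncard : ℝ) := by
  have := hF
  have hswap : {xu : (Fin m → F) × (Fin k → F) | ∀ i j, xu.1 i ≠ xu.2 j}.ncard =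
      {ux : (Fin k → F) × (Fin m → F) | ∀ i j, ux.1 i ≠ ux.2 j}.ncard := by
    rw [← Nat.card_coe_set_eq, ← Nat.card_coe_set_eq]
    refine Nat.card_congr ((Equiv.prodComm _ _).subtypeEquiv fun xu => ?_)
    exact ⟨fun h i j => (h j i).symm, fun h i j => (h j i).symm⟩
  refine ⟨?_, average_eq_ncard_disjoint_tuple_pairs F k m⟩
  rw [average_eq_ncard_disjoint_tuple_pairs F k m, average_eq_ncard_disjoint_tuple_pairs F m k,
    hswap, add_comm m k]
end

section
/- (Symmetry of moments.) For all integers k, m ≥ 1 one has μ_k(m) = μ_m(k), where μ_k(m) = ∏_p (1 − 1/p)^{−km} · (p^{−k} Σ_{u ∈ (ℤ/pℤ)^k} (1 − ρ_p(u)/p)^m), the product being over all primes; in fact the p-factors agree: for every prime p, p^{−k} Σ_{u ∈ (ℤ/pℤ)^k} (1 − ρ_p(u)/p)^m = p^{−m} Σ_{x ∈ (ℤ/pℤ)^m} (1 − ρ_p(x)/p)^k. -/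
open Filter Topology

/-- The number of tuples `x : β → F` avoiding every value of `u`, via the power of the size of the
complement of the range of `u`. -/
lemma card_filter_avoid_range {α β F : Type*} [Fintype β] [DecidableEq β] [Fintype F]
    [Finite α] (u : α → F) [DecidablePred fun x : β → F => ∀ i j, u i ≠ x j] :
    (((Finset.univ : Finset (β → F)).filter fun x => ∀ i j, u i ≠ x j).card : ℝ) =
      ((Fintype.card F : ℝ) - ((Set.range u).ncard : ℝ)) ^ Fintype.card β := by
  classical
  have := Fintype.ofFinite α
  have h : ((Finset.univ : Finset (β → F)).filter fun x => ∀ i j, u i ≠ x j) =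
      Fintype.piFinset fun _ : β => (Finset.univ.image u)ᶜ := by
    ext x
    simp only [Finset.mem_filter, Finset.mem_univ, true_and, Fintype.mem_piFinset,
      Finset.mem_compl, Finset.mem_image, not_exists]
    exact forall_comm
  have hr : (Set.range u).ncard = (Finset.univ.image u).card := by
    rw [← Set.ncard_coe_finset, Finset.coe_image, Finset.coe_univ, Set.image_univ]
  rw [h, Fintype.card_piFinset, Finset.prod_const, Finset.card_univ, Finset.card_compl, hr,
    Nat.cast_pow, Nat.cast_sub (Finset.card_le_univ _)]

/-- `halfTerm k m p` is the proportion of pairs of tuples in `ℤ/p` of lengths `k` and `m` having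
no common value. -/
lemma halfTerm_eq_sum (k m : ℕ) (p : Nat.Primes) [NeZero (p : ℕ)] :
    halfTerm k m p = (((p : ℕ) : ℝ) ^ (k + m))⁻¹ *
      ∑ u : Fin k → ZMod (p : ℕ), ∑ x : Fin m → ZMod (p : ℕ),
        if ∀ i j, u i ≠ x j then (1 : ℝ) else 0 := by
  have hp : ((p : ℕ) : ℝ) ≠ 0 := Nat.cast_ne_zero.mpr p.2.ne_zero
  rw [halfTerm, pow_add, mul_inv, zpow_neg, zpow_natCast, mul_assoc]
  congr 1
  rw [Finset.mul_sum]
  refine Finset.sum_congr rfl fun u _ => ?_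
  rw [Finset.sum_boole, card_filter_avoid_range u, ZMod.card, Fintype.card_fin, ← inv_pow,
    ← mul_pow]
  congr 1
  field_simp

lemma halfTerm_comm (k m : ℕ) (p : Nat.Primes) : halfTerm k m p = halfTerm m k p := by
  have : NeZero (p : ℕ) := ⟨p.2.ne_zero⟩
  rw [halfTerm_eq_sum, halfTerm_eq_sum, Finset.sum_comm, add_comm]
  congr 1
  refine Finset.sum_congr rfl fun x _ => Finset.sum_congr rfl fun u _ => ?_
  refine if_congr ?_ rfl rfl
  exact ⟨fun h i j => (h j i).symm, fun h i j => (h j i).symm⟩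

/-- Symmetry of moments: `μ_k(m) = μ_m(k)` for all integers `k, m ≥ 1`; in fact the
`p`-factors agree: `p^(-k) Σ_{u ∈ (ℤ/p)^k} (1 - ρ_p(u)/p)^m
= p^(-m) Σ_{x ∈ (ℤ/p)^m} (1 - ρ_p(x)/p)^k` for every prime `p`. -/
theorem moments_symmetric (k m : ℕ) (hk : 1 ≤ k) (hm : 1 ≤ m) :
    muMoment k m = muMoment m k ∧
      ∀ p : Nat.Primes, halfTerm k m p = halfTerm m k p := by
  have h := halfTerm_comm k m
  refine ⟨tprod_congr fun p => ?_, h⟩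
  rw [muFactor, muFactor, h p, mul_comm k m]
end
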